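/- arXiv:1310.7716 — 2 statements merged into one kernel-verified Lean document; each statement's English description precedes it below -/
import Mathlib

section
/- Let r ≥ 1, χ : {1,…,r} → {0,1}, and A ∈ GL_r(ℝ). For x, y ∈ (ℝ∖ℤ)^r define L̃_χ(s, A, x, y) = e(−[x]·y) L_χ(s, A, x−[x], y−[y]), where [x] = ([x_1],…,[x_r]) is the componentwise floor, so that x−[x], y−[y] ∈ (0,1)^r. Then: (i) L̃_χ(s, A, x+k, y+l) = e(−k·y) L̃_χ(s, A, x, y) for all k, l ∈ ℤ^r and all s with Re s_ν > 0 for every ν; and (ii) for all s with 0 < Re s_ν < 1 for every ν, |det A|^{1/2} Γ_χ(s) L̃_χ(s, A, x, y) = i_χ e(−x·y) |det A|^{−1/2} Γ_χ(1−s) L̃_χ(1−s, A*, y, 1−x), where A* = (Aᵀ)^{−1}. -/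
open MeasureTheory

noncomputable section

/-- `e z = exp (2 π i z)` -/
def eC (z : ℂ) : ℂ := Complex.exp (2 * Real.pi * Complex.I * z)

/-- `φ(t,x,y) = e(itx)/(1 - e(y + it))` -/
def phiF (t x y : ℝ) : ℂ := eC (Complex.I * t * x) / (1 - eC (y + Complex.I * t))

/-- `F(t,x,y) = ∏_ν φ(t_ν, x_ν, y_ν)` -/
def FF {r : ℕ} (t x y : Fin r → ℝ) : ℂ := ∏ ν, phiF (t ν) (x ν) (y ν)

/-- `Γ_ℝ(s) = π^(-s/2) Γ(s/2)` -/
def GammaR (s : ℂ) : ℂ := (Real.pi : ℂ) ^ (-s / 2) * Complex.Gamma (s / 2)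

/-- `Γ_ℂ(s) = 2 (2π)^(-s) Γ(s)` -/
def GammaC (s : ℂ) : ℂ := 2 * (2 * (Real.pi : ℂ)) ^ (-s) * Complex.Gamma s

/-- the quasi-character `|t|_χ^s = ∏_ν sgn(t_ν)^{χ(ν)} |t_ν|^{s_ν}` -/
def qchar {r : ℕ} (χ : Fin r → ℕ) (s : Fin r → ℂ) (t : Fin r → ℝ) : ℂ :=
  ∏ ν, ((Real.sign (t ν) : ℂ)) ^ (χ ν) * ((|t ν| : ℝ) : ℂ) ^ (s ν)

/-- the Shintani L-function, defined by the integral representation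
`L(s,A,x,y) = 2^r (∏ Γ_ℂ(s_ν))⁻¹ ∫_{(0,∞)^r} F(tA,x,y) t^s ∏ dt_ν/t_ν` -/
def ShintaniL {r : ℕ} (s : Fin r → ℂ) (A : Matrix (Fin r) (Fin r) ℝ)
    (x y : Fin r → ℝ) : ℂ :=
  2 ^ r * (∏ ν, GammaC (s ν))⁻¹ *
    ∫ t in Set.univ.pi fun _ : Fin r => Set.Ioi (0 : ℝ),
      FF (Matrix.vecMul t A) x y * ∏ ν, (((t ν : ℝ) : ℂ) ^ (s ν) * ((t ν : ℝ) : ℂ)⁻¹)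

/-- the normalized Shintani L-function of parity type χ,
`L_χ(s,A,x,y) = (∏ Γ_ℂ(s_ν))⁻¹ ∫_{(ℝ^×)^r} F(tA,x,y) |t|_χ^s ∏ dt_ν/t_ν` -/
def ShintaniLchi {r : ℕ} (χ : Fin r → ℕ) (s : Fin r → ℂ)
    (A : Matrix (Fin r) (Fin r) ℝ) (x y : Fin r → ℝ) : ℂ :=
  (∏ ν, GammaC (s ν))⁻¹ *
    ∫ t : Fin r → ℝ,
      FF (Matrix.vecMul t A) x y * qchar χ s t * ∏ ν, ((t ν : ℝ) : ℂ)⁻¹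

/-- `Γ_χ(s) = ∏_ν Γ_ℝ(s_ν + χ(ν))` -/
def GammaChi {r : ℕ} (χ : Fin r → ℕ) (s : Fin r → ℂ) : ℂ :=
  ∏ ν, GammaR (s ν + (χ ν : ℂ))

/-- the completed normalized Shintani L-function
`L̂_χ(s,A,x,y) = |det A|^{1/2} Γ_χ(s) L_χ(s,A,x,y)` -/
def ShintaniLhat {r : ℕ} (χ : Fin r → ℕ) (s : Fin r → ℂ)
    (A : Matrix (Fin r) (Fin r) ℝ) (x y : Fin r → ℝ) : ℂ :=
  ((Real.sqrt |A.det| : ℝ) : ℂ) * GammaChi χ s * ShintaniLchi χ s A x y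


/-- the quasiperiodic extension `L̃_χ(s,A,x,y) = e(-[x]·y) L_χ(s,A,x-[x],y-[y])` -/
def ShintaniLchiExt {r : ℕ} (χ : Fin r → ℕ) (s : Fin r → ℂ)
    (A : Matrix (Fin r) (Fin r) ℝ) (x y : Fin r → ℝ) : ℂ :=
  eC (-((∑ ν, (⌊x ν⌋ : ℝ) * y ν : ℝ) : ℂ)) *
    ShintaniLchi χ s A (fun ν => Int.fract (x ν)) (fun ν => Int.fract (y ν))

lemma den_bound (y v : ℝ) (_hv : 0 < v) :
    |Real.sin (Real.pi * y)| * (1 + v) ≤ ‖(1 : ℂ) - Complex.exp (2 * Real.pi * Complex.I * y) * v‖ := by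
  apply le_of_sq_le_sq _ (norm_nonneg _)
  rw [← Complex.normSq_eq_norm_sq, mul_pow, sq_abs]
  have h1 : Complex.exp (2 * Real.pi * Complex.I * y)
      = (Real.cos (2 * (Real.pi * y)) : ℂ) + (Real.sin (2 * (Real.pi * y)) : ℂ) * Complex.I := by
    rw [Complex.ofReal_cos, Complex.ofReal_sin, ← Complex.exp_mul_I]
    congr 1; push_cast; ring
  rw [h1, Complex.normSq_apply]
  simp only [Complex.sub_re, Complex.sub_im, Complex.mul_re, Complex.mul_im, Complex.add_re,
    Complex.add_im, Complex.ofReal_re, Complex.ofReal_im, Complex.one_re, Complex.one_im,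
    Complex.I_re, Complex.I_im]
  have h2 := Real.sin_sq_add_cos_sq (2 * (Real.pi * y))
  have h3 : Real.cos (2 * (Real.pi * y)) = 1 - 2 * Real.sin (Real.pi * y) ^ 2 := by
    rw [Real.cos_two_mul]; nlinarith [Real.sin_sq_add_cos_sq (Real.pi * y)]
  have h4 : Real.sin (Real.pi * y) ^ 2 ≤ 1 := Real.sin_sq_le_one _
  set c := Real.cos (2 * (Real.pi * y))
  set S := Real.sin (2 * (Real.pi * y))
  set q := Real.sin (Real.pi * y) ^ 2
  have h5 : 0 ≤ (1 - q) * (1 - v) ^ 2 := mul_nonneg (by linarith) (sq_nonneg _)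
  have h6 : S ^ 2 = 1 - c ^ 2 := by linarith
  ring_nf
  rw [h6, h3]
  nlinarith

lemma sin_pos_of_Ioo {y : ℝ} (h0 : 0 < y) (h1 : y < 1) : 0 < Real.sin (Real.pi * y) :=
  Real.sin_pos_of_pos_of_lt_pi (by positivity) (by nlinarith [Real.pi_pos])

lemma phiF_eq (t x y : ℝ) : phiF t x y =
    ((Real.exp (-2 * Real.pi * t * x) : ℝ) : ℂ) /
      (1 - Complex.exp (2 * Real.pi * Complex.I * y) * (Real.exp (-2 * Real.pi * t) : ℝ)) := by
  unfold phiF eC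
  rw [Complex.ofReal_exp, Complex.ofReal_exp, ← Complex.exp_add]
  congr 2
  · push_cast; ring_nf; rw [Complex.I_sq]; ring
  · congr 1; push_cast; ring_nf; rw [Complex.I_sq]; ring

lemma den_ne (y t : ℝ) (h0 : 0 < y) (h1 : y < 1) :
    (1 - Complex.exp (2 * Real.pi * Complex.I * y) * (Real.exp (-2 * Real.pi * t) : ℝ)) ≠ 0 := by
  have := den_bound y (Real.exp (-2 * Real.pi * t)) (Real.exp_pos _)
  rw [← norm_pos_iff]
  refine lt_of_lt_of_le ?_ this
  have := sin_pos_of_Ioo h0 h1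
  have := Real.exp_pos (-2 * Real.pi * t)
  positivity

lemma phiF_bound (t x y : ℝ) (hx0 : 0 < x) (hx1 : x < 1) (h0 : 0 < y) (h1 : y < 1) :
    ‖phiF t x y‖ ≤ (Real.sin (Real.pi * y))⁻¹ * Real.exp (-(2 * Real.pi * min x (1 - x)) * |t|) := by
  rw [phiF_eq, norm_div, Complex.norm_real, Real.norm_eq_abs, abs_of_pos (Real.exp_pos _)]
  have hs := sin_pos_of_Ioo h0 h1
  have hb := den_bound y (Real.exp (-2 * Real.pi * t)) (Real.exp_pos _)
  rw [abs_of_pos hs] at hb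
  have he := Real.exp_pos (-2 * Real.pi * t)
  rw [div_le_iff₀ (lt_of_lt_of_le (by positivity) hb)]
  refine le_trans ?_ (mul_le_mul_of_nonneg_left hb (by positivity))
  have hpi := Real.pi_pos
  rw [show ∀ a b c d : ℝ, a * b * (c * d) = (a * c) * (b * d) by intros; ring, inv_mul_cancel₀ hs.ne',
    one_mul, mul_add, mul_one, ← Real.exp_add]
  rcases le_total 0 t with ht | ht
  · rw [abs_of_nonneg ht]
    refine le_trans ?_ (le_add_of_nonneg_right (Real.exp_pos _).le)
    apply Real.exp_le_exp.2
    have : t * min x (1 - x) ≤ t * x := mul_le_mul_of_nonneg_left (min_le_left _ _) ht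
    nlinarith
  · rw [abs_of_nonpos ht]
    refine le_trans ?_ (le_add_of_nonneg_left (Real.exp_pos _).le)
    apply Real.exp_le_exp.2
    have : (-t) * min x (1 - x) ≤ (-t) * (1 - x) := mul_le_mul_of_nonneg_left (min_le_right _ _) (by linarith)
    nlinarith

lemma phiF_cont (x y : ℝ) (h0 : 0 < y) (h1 : y < 1) : Continuous fun t => phiF t x y := by
  simp_rw [phiF_eq]
  refine Continuous.div ?_ ?_ (fun t => den_ne y t h0 h1)
  · fun_prop
  · fun_prop

lemma integrable_abs_of_Ioi {f : ℝ → ℝ} (hf : IntegrableOn f (Set.Ioi 0)) :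
    Integrable fun t : ℝ => f |t| := by
  have h1 : IntegrableOn (fun t : ℝ => f |t|) (Set.Ioi 0) :=
    hf.congr_fun (fun t ht => by simp only [abs_of_pos (Set.mem_Ioi.1 ht)]) measurableSet_Ioi
  rw [← integrableOn_univ, ← Set.Iic_union_Ioi (a := (0 : ℝ)), integrableOn_union]
  refine ⟨?_, h1⟩
  rw [integrableOn_Iic_iff_integrableOn_Iio]
  rw [← (Measure.measurePreserving_neg (volume : Measure ℝ)).integrableOn_comp_preimage
      (Homeomorph.neg ℝ).measurableEmbedding]
  simpa [Function.comp_def] using h1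

lemma integrable_rpow_exp_abs {c σ : ℝ} (hc : 0 < c) (hσ : 0 < σ) :
    Integrable fun t : ℝ => |t| ^ (σ - 1) * Real.exp (-c * |t|) := by
  have h := integrableOn_rpow_mul_exp_neg_mul_rpow (p := 1) (s := σ - 1) (b := c) (by linarith) one_pos hc
  simp only [Real.rpow_one] at h
  exact integrable_abs_of_Ioi h

lemma integrable_exp_abs {c : ℝ} (hc : 0 < c) : Integrable fun t : ℝ => Real.exp (-c * |t|) := by
  simpa using integrable_rpow_exp_abs hc one_pos

lemma phiF_integrable (x y : ℝ) (hx0 : 0 < x) (hx1 : x < 1) (h0 : 0 < y) (h1 : y < 1) :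
    Integrable fun t => phiF t x y := by
  have hm : 0 < min x (1 - x) := lt_min hx0 (by linarith)
  have hc : 0 < 2 * Real.pi * min x (1 - x) := by positivity
  exact ((integrable_exp_abs hc).const_mul _).mono' (phiF_cont x y h0 h1).aestronglyMeasurable
    (Filter.Eventually.of_forall fun t => phiF_bound t x y hx0 hx1 h0 h1)

open Filter Topology in
lemma beta_int (w : ℂ) (h0 : 0 < w.re) (h1 : w.re < 1) :
    ∫ t : ℝ, Complex.exp (-2 * Real.pi * t * w) / (1 + (Real.exp (-2 * Real.pi * t) : ℝ)) =
      1 / (2 * Complex.sin (Real.pi * w)) := by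
  have hpi := Real.pi_pos
  have hG := Complex.Gamma_mul_Gamma_one_sub w
  have hB := Complex.betaIntegral_eq_Gamma_mul_div w (1 - w) h0 (by simpa using h1)
  rw [hG, add_sub_cancel, Complex.Gamma_one, div_one, Complex.betaIntegral,
    intervalIntegral.integral_of_le zero_le_one, integral_Ioc_eq_integral_Ioo] at hB
  let f : ℝ → ℝ := fun t => (1 + Real.exp (2 * Real.pi * t))⁻¹
  let f' : ℝ → ℝ := fun t => -(2 * Real.pi * Real.exp (2 * Real.pi * t)) / (1 + Real.exp (2 * Real.pi * t)) ^ 2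
  have hpos : ∀ t : ℝ, 0 < 1 + Real.exp (2 * Real.pi * t) := fun t => by positivity
  have himg : f '' Set.univ = Set.Ioo 0 1 := by
    ext u
    simp only [Set.image_univ, Set.mem_range, Set.mem_Ioo, f]
    constructor
    · rintro ⟨t, rfl⟩
      exact ⟨inv_pos.2 (hpos t), inv_lt_one_of_one_lt₀ (by linarith [Real.exp_pos (2 * Real.pi * t)])⟩
    · rintro ⟨hu0, hu1⟩
      refine ⟨Real.log (u⁻¹ - 1) / (2 * Real.pi), ?_⟩
      rw [mul_div_cancel₀ _ (by positivity), Real.exp_log]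
      · simp
      · have := (one_lt_inv₀ hu0).2 hu1
        linarith
  have hder : ∀ t ∈ Set.univ, HasDerivWithinAt f (f' t) Set.univ t := by
    intro t _
    apply HasDerivAt.hasDerivWithinAt
    have h := (((hasDerivAt_id t).const_mul (2 * Real.pi)).exp.const_add 1).inv (hpos t).ne'
    refine h.congr_deriv ?_
    simp only [f', id, mul_one]; ring
  have hinj : Set.InjOn f Set.univ := by
    intro a _ b _ hab
    simp only [f, inv_inj, add_right_inj, Real.exp_eq_exp] at hab
    exact mul_left_cancel₀ (by positivity) hab
  rw [← himg, integral_image_eq_integral_abs_deriv_smul MeasurableSet.univ hder hinj,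
    Measure.restrict_univ] at hB
  have key : ∀ t : ℝ, |f' t| • ((f t : ℂ) ^ (w - 1) * (1 - (f t : ℂ)) ^ (1 - w - 1)) =
      (2 * Real.pi) * (Complex.exp (-2 * Real.pi * t * w) / (1 + (Real.exp (-2 * Real.pi * t) : ℝ))) := by
    intro t
    set E := Real.exp (2 * Real.pi * t) with hE
    have hEp : 0 < E := Real.exp_pos _
    have e1 : Real.exp (-2 * Real.pi * t) = E⁻¹ := by rw [hE, ← Real.exp_neg]; ring_nf
    have e2 : (1 - (f t : ℂ)) = ((E * f t : ℝ) : ℂ) := by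
      simp only [f]; rw [← hE]; push_cast
      have : (1 + (E : ℂ)) ≠ 0 := by exact_mod_cast (hpos t).ne'
      field_simp; ring
    have e3 : |f' t| = 2 * Real.pi * E * (f t) ^ 2 := by
      simp only [f', f]; rw [← hE, neg_div, abs_neg, abs_of_pos (by positivity)]; field_simp
    have hfp : 0 < f t := inv_pos.2 (hpos t)
    have e4 : Complex.exp (-2 * Real.pi * t * w) = (E : ℂ) ^ (-w) := by
      rw [Complex.cpow_def_of_ne_zero (by exact_mod_cast hEp.ne'), ← Complex.ofReal_log hEp.le, hE, Real.log_exp]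
      congr 1; push_cast; ring
    rw [e2, e3, e1, e4, Complex.ofReal_mul, Complex.mul_cpow_ofReal_nonneg hEp.le hfp.le,
      Complex.real_smul]
    have hfc : (f t : ℂ) ≠ 0 := by exact_mod_cast hfp.ne'
    have hEc : (E : ℂ) ≠ 0 := by exact_mod_cast hEp.ne'
    have e5 : (f t : ℂ) ^ (w - 1) * (f t : ℂ) ^ (1 - w - 1) = (f t : ℂ)⁻¹ := by
      rw [← Complex.cpow_add _ _ hfc, show (w - 1) + (1 - w - 1) = -1 by ring, Complex.cpow_neg_one]
    have e6 : (f t : ℂ) = (1 + (E : ℂ))⁻¹ := by simp only [f]; rw [← hE]; push_cast; rfl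
    rw [show (f t : ℂ) ^ (w - 1) * ((E : ℂ) ^ (1 - w - 1) * (f t : ℂ) ^ (1 - w - 1)) =
       (E : ℂ) ^ (1 - w - 1) * ((f t : ℂ) ^ (w - 1) * (f t : ℂ) ^ (1 - w - 1)) by ring, e5,
       show (1 - w - 1) = -w by ring]
    push_cast
    have h7 : (1 + (E : ℂ)) ≠ 0 := by exact_mod_cast (hpos t).ne'
    have h8 : (1 + (E : ℂ)⁻¹) ≠ 0 := by
      have : (1 + E⁻¹) ≠ 0 := by positivity
      exact_mod_cast this
    rw [e6]
    have h9 : 1 + (E : ℂ)⁻¹ = (1 + E) * (E : ℂ)⁻¹ := by field_simp; ring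
    rw [h9]
    field_simp
  simp_rw [key] at hB
  rw [integral_const_mul] at hB
  have hpc : (Real.pi : ℂ) ≠ 0 := by exact_mod_cast hpi.ne'
  have h2 : (2 * (Real.pi : ℂ)) ≠ 0 := mul_ne_zero two_ne_zero hpc
  apply mul_left_cancel₀ h2
  rw [hB]
  by_cases hs : Complex.sin (Real.pi * w) = 0
  · rw [hs]; simp
  field_simp

/-- the integrand of the contour argument -/
def Gz (w z : ℂ) : ℂ := Complex.exp (-2 * Real.pi * z * w) / (1 - Complex.exp (-2 * Real.pi * z))

lemma exp_split (a b : ℝ) : Complex.exp (-2 * Real.pi * (a + b * Complex.I)) =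
    Complex.exp (2 * Real.pi * Complex.I * ((-b : ℝ) : ℂ)) * (Real.exp (-2 * Real.pi * a) : ℝ) := by
  rw [Complex.ofReal_exp, ← Complex.exp_add]; congr 1; push_cast; ring

lemma Gz_phi (x ξ y t : ℝ) : Gz (x + ξ * Complex.I) (t + (-y : ℝ) * Complex.I) =
    eC (y * (x + ξ * Complex.I)) * (phiF t x y * eC (-(t * ξ : ℝ))) := by
  unfold Gz
  rw [exp_split, phiF_eq, neg_neg]
  rw [div_mul_eq_mul_div, ← mul_div_assoc]
  congr 1
  unfold eC
  rw [Complex.ofReal_exp, ← Complex.exp_add, ← Complex.exp_add]; congr 1; push_cast; ring_nf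

lemma norm_eC_real (a : ℝ) : ‖eC (a : ℂ)‖ = 1 := by
  unfold eC
  rw [show (2 * Real.pi * Complex.I * a : ℂ) = ((2 * Real.pi * a : ℝ) : ℂ) * Complex.I by push_cast; ring]
  exact Complex.norm_exp_ofReal_mul_I _

lemma cont_eC : Continuous eC := by unfold eC; fun_prop

lemma phi_four_integrable (x y ξ : ℝ) (hx0 : 0 < x) (hx1 : x < 1) (h0 : 0 < y) (h1 : y < 1) :
    Integrable fun t : ℝ => phiF t x y * eC (-(t * ξ : ℝ)) := by
  refine (phiF_integrable x y hx0 hx1 h0 h1).mono ?_ ?_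
  · apply Continuous.aestronglyMeasurable
    exact (phiF_cont x y h0 h1).mul (cont_eC.comp (by fun_prop))
  · refine Filter.Eventually.of_forall fun t => ?_
    rw [norm_mul, ← Complex.ofReal_neg, norm_eC_real, mul_one]

lemma Gz_integrable (x y ξ : ℝ) (hx0 : 0 < x) (hx1 : x < 1) (h0 : 0 < y) (h1 : y < 1) :
    Integrable fun t : ℝ => Gz (x + ξ * Complex.I) (t + (-y : ℝ) * Complex.I) := by
  simp_rw [Gz_phi]
  exact (phi_four_integrable x y ξ hx0 hx1 h0 h1).const_mul _

lemma Gz_bound (x ξ T b : ℝ) (hb : |b| ≤ 1) (hT : T ≠ 0) :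
    ‖Gz (x + ξ * Complex.I) (T + b * Complex.I)‖ ≤
      Real.exp (2 * Real.pi * |ξ|) * (Real.exp (-2 * Real.pi * T * x) / |1 - Real.exp (-2 * Real.pi * T)|) := by
  unfold Gz
  have hpi := Real.pi_pos
  rw [norm_div, ← mul_div_assoc]
  have hne : Real.exp (-2 * Real.pi * T) ≠ 1 := by
    rw [Ne, Real.exp_eq_one_iff]; simp [hT, hpi.ne']
  have hp : 0 < |1 - Real.exp (-2 * Real.pi * T)| := abs_pos.2 (sub_ne_zero.2 hne.symm)
  gcongr
  · rw [Complex.norm_exp, ← Real.exp_add]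
    apply Real.exp_le_exp.2
    have h1 : (-2 * Real.pi * (T + b * Complex.I) * (x + ξ * Complex.I) : ℂ).re =
        2 * Real.pi * (b * ξ) + -2 * Real.pi * T * x := by
      simp; ring
    rw [h1]
    have h2 : b * ξ ≤ |ξ| := by
      calc b * ξ ≤ |b * ξ| := le_abs_self _
        _ = |b| * |ξ| := abs_mul _ _
        _ ≤ 1 * |ξ| := by gcongr
        _ = |ξ| := one_mul _
    gcongr
  · rw [exp_split]
    refine le_trans ?_ (abs_norm_sub_norm_le _ _)
    rw [norm_mul, norm_one]
    have : ‖Complex.exp (2 * Real.pi * Complex.I * ((-b : ℝ) : ℂ))‖ = 1 := norm_eC_real (-b)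
    rw [this, one_mul, Complex.norm_real, Real.norm_eq_abs, abs_of_pos (Real.exp_pos _)]

open Filter Topology in
lemma contour (x y ξ : ℝ) (hx0 : 0 < x) (hx1 : x < 1) (h0 : 0 < y) (h1 : y < 1) :
    ∫ t : ℝ, Gz (x + ξ * Complex.I) (t + (-y : ℝ) * Complex.I) =
    ∫ t : ℝ, Gz (x + ξ * Complex.I) (t + (-(1/2 : ℝ) : ℝ) * Complex.I) := by
  have hpi := Real.pi_pos
  set w : ℂ := x + ξ * Complex.I with hw
  have rect : ∀ T : ℝ, (∫ t : ℝ in (-T)..T, Gz w (t + (-y : ℝ) * Complex.I)) -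
      (∫ t : ℝ in (-T)..T, Gz w (t + (-(1/2 : ℝ) : ℝ) * Complex.I)) +
      Complex.I • (∫ b : ℝ in (-y)..(-(1/2 : ℝ)), Gz w ((T : ℝ) + b * Complex.I)) -
      Complex.I • (∫ b : ℝ in (-y)..(-(1/2 : ℝ)), Gz w ((-T : ℝ) + b * Complex.I)) = 0 := by
    intro T
    refine Complex.integral_boundary_rect_eq_zero_of_differentiableOn (Gz w) ⟨-T, -y⟩ ⟨T, -(1/2)⟩ ?_
    intro z hz
    have him : -1 < z.im ∧ z.im < 0 := by
      have := hz.2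
      simp only [Set.mem_preimage, Set.mem_uIcc] at this
      rcases this with h | h <;> constructor <;> linarith [h.1, h.2]
    apply DifferentiableAt.differentiableWithinAt
    unfold Gz
    apply DifferentiableAt.div
    · fun_prop
    · fun_prop
    · have := exp_split z.re z.im
      rw [Complex.re_add_im] at this
      rw [this]
      exact den_ne _ _ (by linarith) (by linarith)
  have hlim1 : Tendsto (fun T : ℝ => ∫ t : ℝ in (-T)..T, Gz w (t + (-y : ℝ) * Complex.I)) atTop
      (𝓝 (∫ t : ℝ, Gz w (t + (-y : ℝ) * Complex.I))) :=
    intervalIntegral_tendsto_integral (Gz_integrable x y ξ hx0 hx1 h0 h1) tendsto_neg_atTop_atBot tendsto_id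
  have hlim2 : Tendsto (fun T : ℝ => ∫ t : ℝ in (-T)..T, Gz w (t + (-(1/2 : ℝ) : ℝ) * Complex.I)) atTop
      (𝓝 (∫ t : ℝ, Gz w (t + (-(1/2 : ℝ) : ℝ) * Complex.I))) :=
    intervalIntegral_tendsto_integral (Gz_integrable x (1/2) ξ hx0 hx1 (by norm_num) (by norm_num))
      tendsto_neg_atTop_atBot tendsto_id
  have vert : ∀ S : ℝ, S ≠ 0 → ‖∫ b : ℝ in (-y)..(-(1/2 : ℝ)), Gz w ((S : ℝ) + b * Complex.I)‖ ≤
      Real.exp (2 * Real.pi * |ξ|) * (Real.exp (-2 * Real.pi * S * x) / |1 - Real.exp (-2 * Real.pi * S)|)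
        * |-(1/2 : ℝ) - (-y)| := by
    intro S hS
    apply intervalIntegral.norm_integral_le_of_norm_le_const
    intro b hb
    apply Gz_bound _ _ _ _ _ hS
    have := Set.uIoc_subset_uIcc hb
    rw [Set.mem_uIcc] at this
    rw [abs_le]
    rcases this with h | h <;> constructor <;> linarith [h.1, h.2]
  have hexp : ∀ c : ℝ, 0 < c → Tendsto (fun T : ℝ => Real.exp (-(c * T))) atTop (𝓝 0) := fun c hc =>
    Real.tendsto_exp_neg_atTop_nhds_zero.comp (tendsto_id.const_mul_atTop hc)
  have hlim3 : Tendsto (fun T : ℝ => ∫ b : ℝ in (-y)..(-(1/2 : ℝ)), Gz w ((T : ℝ) + b * Complex.I)) atTop (𝓝 0) := by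
    refine squeeze_zero_norm' ((eventually_gt_atTop 0).mono fun T hT => vert T hT.ne') ?_
    have e1 := hexp (2 * Real.pi * x) (by positivity)
    have e2 := hexp (2 * Real.pi) (by positivity)
    have e3 := ((e1.div ((tendsto_const_nhds (x := (1 : ℝ))).sub e2).abs (by simp)).const_mul
      (Real.exp (2 * Real.pi * |ξ|))).mul_const |-(1/2 : ℝ) - (-y)|
    simp only [zero_div, mul_zero, zero_mul, Pi.div_apply] at e3
    refine e3.congr fun T => ?_
    ring_nf
  have hlim4 : Tendsto (fun T : ℝ => ∫ b : ℝ in (-y)..(-(1/2 : ℝ)), Gz w ((-T : ℝ) + b * Complex.I)) atTop (𝓝 0) := by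
    refine squeeze_zero_norm' ((eventually_gt_atTop 0).mono fun T hT => vert (-T) (by linarith)) ?_
    have e1 := hexp (2 * Real.pi * (1 - x)) (mul_pos (by positivity) (by linarith))
    have e2 := hexp (2 * Real.pi) (by positivity)
    have e3 := ((e1.div (e2.sub (tendsto_const_nhds (x := (1 : ℝ)))).abs (by simp)).const_mul
      (Real.exp (2 * Real.pi * |ξ|))).mul_const |-(1/2 : ℝ) - (-y)|
    simp only [zero_div, mul_zero, zero_mul, Pi.div_apply] at e3
    refine e3.congr fun T => ?_
    congr 2
    have E1 : Real.exp (-(2 * Real.pi * T)) - 1 =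
        Real.exp (-(2 * Real.pi * T)) * (1 - Real.exp (-2 * Real.pi * -T)) := by
      rw [mul_sub, ← Real.exp_add, mul_one, show -(2 * Real.pi * T) + -2 * Real.pi * -T = 0 by ring, Real.exp_zero]
    have E2 : Real.exp (-(2 * Real.pi * (1 - x) * T)) =
        Real.exp (-(2 * Real.pi * T)) * Real.exp (-2 * Real.pi * -T * x) := by
      rw [← Real.exp_add]; ring_nf
    rw [E1, E2, abs_mul, abs_of_pos (Real.exp_pos _), mul_div_mul_left _ _ (Real.exp_pos _).ne']
  have H := ((hlim1.sub hlim2).add (hlim3.const_smul Complex.I)).sub (hlim4.const_smul Complex.I)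
  simp_rw [rect] at H
  have := tendsto_nhds_unique H tendsto_const_nhds
  simp only [smul_zero, add_zero, sub_zero] at this
  exact sub_eq_zero.1 this

lemma eC_add (a b : ℂ) : eC (a + b) = eC a * eC b := by
  unfold eC; rw [← Complex.exp_add]; ring_nf

lemma eC_zero : eC 0 = 1 := by simp [eC]

lemma eC_ne (a : ℂ) : eC a ≠ 0 := Complex.exp_ne_zero _

lemma eC_int (n : ℤ) : eC n = 1 := by
  unfold eC; rw [Complex.exp_eq_one_iff]; exact ⟨n, by ring⟩

lemma phi_fourier (x y ξ : ℝ) (hx0 : 0 < x) (hx1 : x < 1) (h0 : 0 < y) (h1 : y < 1) :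
    ∫ t : ℝ, phiF t x y * eC (-(t * ξ : ℝ)) =
      Complex.I * eC (-(x * y : ℝ)) * phiF (-ξ) y (1 - x) := by
  have hc := contour x y ξ hx0 hx1 h0 h1
  have hb := beta_int (x + ξ * Complex.I) (by simpa using hx0) (by simpa using hx1)
  set w : ℂ := x + ξ * Complex.I with hw
  have h2 : ∀ t : ℝ, Gz w (t + (-(1/2 : ℝ) : ℝ) * Complex.I) = eC (w / 2) *
      (Complex.exp (-2 * Real.pi * t * w) / (1 + (Real.exp (-2 * Real.pi * t) : ℝ))) := by
    intro t
    unfold Gz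
    rw [exp_split, neg_neg]
    have : Complex.exp (2 * Real.pi * Complex.I * ((1/2 : ℝ) : ℂ)) = -1 := by
      rw [← Complex.exp_pi_mul_I]; congr 1; push_cast; ring
    rw [this, ← mul_div_assoc]
    congr 1
    · unfold eC
      rw [← Complex.exp_add]; congr 1; push_cast; ring
    · ring
  simp_rw [h2] at hc
  rw [integral_const_mul, hb] at hc
  simp_rw [hw, Gz_phi] at hc
  rw [integral_const_mul, ← hw] at hc
  apply mul_left_cancel₀ (eC_ne (y * w))
  rw [hc]
  have hphi : phiF (-ξ) y (1 - x) = eC (-(y * w)) * eC (x * y) / (1 - eC (-w)) := by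
    unfold phiF
    congr 1
    · rw [← eC_add]; congr 1; rw [hw]; push_cast; ring
    · congr 1
      rw [← mul_one (eC (-w)), ← eC_int 1, ← eC_add]; congr 1; rw [hw]; push_cast; ring
  rw [hphi]
  have hinv : eC (y * w) * eC (-(y * w)) = 1 := by rw [← eC_add, add_neg_cancel, eC_zero]
  have hinv2 : eC (-(x * y : ℝ)) * eC (x * y) = 1 := by
    rw [← eC_add, ← eC_zero]; congr 1; push_cast; ring
  have hsin : 2 * Complex.sin (Real.pi * w) = -Complex.I * (eC (w/2) * (1 - eC (-w))) := by
    rw [mul_sub, ← eC_add, Complex.sin]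
    unfold eC
    rw [mul_one, mul_div_cancel₀ _ two_ne_zero]
    have a1 : 2 * (Real.pi : ℂ) * Complex.I * (w / 2) = Real.pi * w * Complex.I := by ring
    have a2 : 2 * (Real.pi : ℂ) * Complex.I * (w / 2 + -w) = -(Real.pi * w) * Complex.I := by ring
    rw [a1, a2]; ring
  rw [hsin]
  have e5 := eC_ne (w/2)
  calc eC (w / 2) * (1 / (-Complex.I * (eC (w / 2) * (1 - eC (-w))))) = Complex.I / (1 - eC (-w)) := by
        rw [one_div, mul_inv, mul_inv, inv_neg, Complex.inv_I, neg_neg]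
        rw [show ∀ a b c d : ℂ, a * (b * (c * d)) = (a * c) * (b * d) by intros; ring, mul_inv_cancel₀ e5]
        rw [one_mul, div_eq_mul_inv]
    _ = Complex.I * (eC (y * w) * eC (-(y * w))) * (eC (-(x * y : ℝ)) * eC (x * y)) / (1 - eC (-w)) := by
        rw [hinv, hinv2, mul_one, mul_one]
    _ = _ := by ring

/-- first kernel -/
def k1 (ε : ℕ) (p : ℂ) (t a : ℝ) : ℂ :=
  (t : ℂ) ^ ε * ((a : ℂ) ^ (p / 2 - 1) * Complex.exp (-((Real.pi * t ^ 2 : ℝ) * a)))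

/-- second kernel -/
def k2 (ε : ℕ) (p : ℂ) (t a : ℝ) : ℂ :=
  (t : ℂ) ^ ε * ((a : ℂ) ^ (-p / 2 - 1) * Complex.exp (-((Real.pi * t ^ 2 : ℝ) * (a : ℂ)⁻¹)))

lemma abs_cpow_aux (t : ℝ) (ht : t ≠ 0) (p : ℂ) :
    (1 / ((Real.pi * t ^ 2 : ℝ) : ℂ)) ^ (p / 2) = (Real.pi : ℂ) ^ (-p / 2) * ((|t| : ℝ) : ℂ) ^ (-p) := by
  have ha : 0 < |t| := abs_pos.2 ht
  have hpi := Real.pi_pos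
  have hac : ((|t| : ℝ) : ℂ) ≠ 0 := by exact_mod_cast ha.ne'
  rw [← sq_abs, one_div, ← Complex.ofReal_inv, mul_inv, Complex.ofReal_mul,
    Complex.mul_cpow_ofReal_nonneg (by positivity) (by positivity)]
  congr 1
  · rw [Complex.ofReal_inv, Complex.inv_cpow, ← Complex.cpow_neg, neg_div]
    rw [Complex.arg_ofReal_of_nonneg hpi.le]; exact hpi.ne
  · rw [Complex.cpow_def_of_ne_zero (by exact_mod_cast (by positivity)), Complex.cpow_def_of_ne_zero hac,
      ← Complex.ofReal_log (by positivity), ← Complex.ofReal_log ha.le, Real.log_inv, Real.log_pow]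
    congr 1; push_cast; ring

lemma int_k1 (ε : ℕ) (p : ℂ) (hp : 0 < p.re) (t : ℝ) (ht : t ≠ 0) :
    ∫ a in Set.Ioi (0 : ℝ), k1 ε p t a =
      Complex.Gammaℝ p * ((t : ℂ) ^ ε * ((|t| : ℝ) : ℂ) ^ (-p)) := by
  unfold k1
  have hpi := Real.pi_pos
  have h := Complex.integral_cpow_mul_exp_neg_mul_Ioi (a := p / 2) (r := Real.pi * t ^ 2)
    (by simpa using hp) (by positivity)
  rw [integral_const_mul, h, abs_cpow_aux t ht, Complex.Gammaℝ_def]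
  ring

lemma int_k2 (ε : ℕ) (p : ℂ) (hp : 0 < p.re) (t : ℝ) (ht : t ≠ 0) :
    ∫ a in Set.Ioi (0 : ℝ), k2 ε p t a =
      Complex.Gammaℝ p * ((t : ℂ) ^ ε * ((|t| : ℝ) : ℂ) ^ (-p)) := by
  rw [← int_k1 ε p hp t ht, ← integral_comp_rpow_Ioi (k1 ε p t) (p := -1) (by norm_num)]
  apply setIntegral_congr_fun measurableSet_Ioi
  intro a ha
  have ha : 0 < a := ha
  have hac : (a : ℂ) ≠ 0 := by exact_mod_cast ha.ne'
  simp only [k1, k2, Real.rpow_neg_one, abs_neg, abs_one, one_mul, Complex.real_smul]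
  have e1 : ((a⁻¹ : ℝ) : ℂ) ^ (p / 2 - 1) = (a : ℂ) ^ (-(p / 2 - 1)) := by
    rw [Complex.ofReal_inv, Complex.inv_cpow, ← Complex.cpow_neg]
    rw [Complex.arg_ofReal_of_nonneg ha.le]; exact Real.pi_pos.ne
  have e2 : ((a ^ (-1 - 1 : ℝ) : ℝ) : ℂ) = (a : ℂ) ^ (-2 : ℂ) := by
    rw [Complex.ofReal_cpow ha.le]; norm_num
  rw [e1, e2]
  have e3 : (a : ℂ) ^ (-p / 2 - 1) = (a : ℂ) ^ (-2 : ℂ) * (a : ℂ) ^ (-(p / 2 - 1)) := by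
    rw [← Complex.cpow_add _ _ hac]; congr 1; ring
  rw [e3, Complex.ofReal_inv]; ring

lemma norm_k1 (ε : ℕ) (p : ℂ) (t a : ℝ) (ha : 0 < a) :
    ((‖k1 ε p t a‖ : ℝ) : ℂ) = k1 ε (p.re : ℂ) |t| a := by
  unfold k1
  rw [norm_mul, norm_mul, norm_pow, Complex.norm_real, Real.norm_eq_abs,
    Complex.norm_cpow_eq_rpow_re_of_pos ha, Complex.norm_exp]
  push_cast
  rw [Complex.ofReal_cpow ha.le, ← Complex.ofReal_pow |t| 2, sq_abs]
  congr 2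
  · simp
  · congr 1; rw [← Complex.ofReal_pow, ← Complex.ofReal_mul, ← Complex.ofReal_mul, ← Complex.ofReal_neg, Complex.ofReal_re]

lemma norm_k2 (ε : ℕ) (p : ℂ) (t a : ℝ) (ha : 0 < a) :
    ((‖k2 ε p t a‖ : ℝ) : ℂ) = k2 ε (p.re : ℂ) |t| a := by
  unfold k2
  rw [norm_mul, norm_mul, norm_pow, Complex.norm_real, Real.norm_eq_abs,
    Complex.norm_cpow_eq_rpow_re_of_pos ha, Complex.norm_exp]
  push_cast
  rw [Complex.ofReal_cpow ha.le, ← Complex.ofReal_pow |t| 2, sq_abs]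
  congr 2
  · simp
  · congr 1; rw [← Complex.ofReal_pow, ← Complex.ofReal_inv, ← Complex.ofReal_mul, ← Complex.ofReal_mul, ← Complex.ofReal_neg, Complex.ofReal_re]

lemma meas_k1 (ε : ℕ) (p : ℂ) : Measurable (fun q : ℝ × ℝ => k1 ε p q.1 q.2) := by
  unfold k1
  have : Measurable (fun q : ℝ × ℝ => (q.2 : ℂ) ^ (p / 2 - 1)) :=
    (Complex.measurable_ofReal.comp measurable_snd).pow_const _
  fun_prop

lemma meas_k2 (ε : ℕ) (p : ℂ) : Measurable (fun q : ℝ × ℝ => k2 ε p q.1 q.2) := by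
  unfold k2
  have : Measurable (fun q : ℝ × ℝ => (q.2 : ℂ) ^ (-p / 2 - 1)) :=
    (Complex.measurable_ofReal.comp measurable_snd).pow_const _
  fun_prop

/-- what the swap lemma needs to know about a kernel -/
def GoodKer (k : ℝ → ℝ → ℂ) (σ : ℝ) : Prop :=
  Measurable (fun q : ℝ × ℝ => k q.1 q.2) ∧ ∃ M : ℝ, ∀ t : ℝ, t ≠ 0 →
    IntegrableOn (k t) (Set.Ioi 0) ∧ ∫ a in Set.Ioi (0 : ℝ), ‖k t a‖ = M * |t| ^ (σ - 1)

lemma good_aux (k : ℕ → ℂ → ℝ → ℝ → ℂ) (hm : ∀ ε p, Measurable (fun q : ℝ × ℝ => k ε p q.1 q.2))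
    (hn : ∀ ε p t a, 0 < a → ((‖k ε p t a‖ : ℝ) : ℂ) = k ε (p.re : ℂ) |t| a)
    (hi : ∀ ε p, 0 < p.re → ∀ t : ℝ, t ≠ 0 → ∫ a in Set.Ioi (0 : ℝ), k ε p t a =
      Complex.Gammaℝ p * ((t : ℂ) ^ ε * ((|t| : ℝ) : ℂ) ^ (-p))) (ε : ℕ) (p : ℂ) (hp : 0 < p.re) :
    GoodKer (k ε p) (ε - p.re + 1) := by
  refine ⟨hm ε p, (Complex.Gammaℝ (p.re : ℂ)).re, fun t ht => ⟨?_, ?_⟩⟩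
  · by_contra hcon
    have h1 := integral_undef hcon
    rw [hi ε p hp t ht] at h1
    have htc : (t : ℂ) ≠ 0 := by exact_mod_cast ht
    have hac : ((|t| : ℝ) : ℂ) ≠ 0 := by exact_mod_cast (abs_pos.2 ht).ne'
    have h2 := Complex.Gammaℝ_ne_zero_of_re_pos hp
    have h3 : ((|t| : ℝ) : ℂ) ^ (-p) ≠ 0 := by
      rw [Complex.cpow_def_of_ne_zero hac]; exact Complex.exp_ne_zero _
    exact mul_ne_zero h2 (mul_ne_zero (pow_ne_zero _ htc) h3) h1
  · have hap := abs_pos.2 ht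
    have h1 : ((∫ a in Set.Ioi (0 : ℝ), ‖k ε p t a‖ : ℝ) : ℂ) =
        Complex.Gammaℝ (p.re : ℂ) * ((|t| ^ (ε - p.re + 1 - 1) : ℝ) : ℂ) := by
      rw [← integral_complex_ofReal, setIntegral_congr_fun measurableSet_Ioi (fun a ha => hn ε p t a ha),
        hi ε p.re (by simpa using hp) |t| hap.ne', abs_abs]
      congr 1
      rw [add_sub_cancel_right, sub_eq_add_neg, Real.rpow_add hap, Real.rpow_natCast, Complex.ofReal_mul, Complex.ofReal_pow,
        Complex.ofReal_cpow hap.le]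
      push_cast; rfl
    have h2 := congrArg Complex.re h1
    rwa [Complex.ofReal_re, Complex.re_mul_ofReal] at h2

lemma good_k1 (ε : ℕ) (p : ℂ) (hp : 0 < p.re) : GoodKer (k1 ε p) (ε - p.re + 1) :=
  good_aux k1 meas_k1 norm_k1 int_k1 ε p hp

lemma good_k2 (ε : ℕ) (p : ℂ) (hp : 0 < p.re) : GoodKer (k2 ε p) (ε - p.re + 1) :=
  good_aux k2 meas_k2 norm_k2 int_k2 ε p hp

/-- exponential decay -/
def ExpDecay {r : ℕ} (f : (Fin r → ℝ) → ℂ) : Prop :=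
  Continuous f ∧ ∃ C c : ℝ, 0 < c ∧ ∀ t, ‖f t‖ ≤ C * ∏ ν, Real.exp (-c * |t ν|)

lemma ae_ne_zero (r : ℕ) : ∀ᵐ t : Fin r → ℝ, ∀ ν, t ν ≠ 0 := by
  rw [ae_all_iff]; intro ν
  exact Measure.ae_eval_ne (μ := fun _ : Fin r => (volume : Measure ℝ)) ν 0

/-- the product of the half-line measures -/
abbrev muP (r : ℕ) : Measure (Fin r → ℝ) := Measure.pi fun _ : Fin r => volume.restrict (Set.Ioi (0 : ℝ))

lemma swap_lemma {r : ℕ} (f : (Fin r → ℝ) → ℂ) (hf : ExpDecay f) (k : Fin r → ℝ → ℝ → ℂ)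
    (σ : Fin r → ℝ) (hσ : ∀ ν, 0 < σ ν) (hk : ∀ ν, GoodKer (k ν) (σ ν)) :
    ∫ t, f t * ∏ ν, (∫ a in Set.Ioi (0 : ℝ), k ν (t ν) a) =
      ∫ a, (∫ t, f t * ∏ ν, k ν (t ν) (a ν)) ∂(muP r) := by
  obtain ⟨hfc, C, c, hc, hfb⟩ := hf
  choose hkm M hM using hk
  have hmeas : Measurable (fun q : (Fin r → ℝ) × (Fin r → ℝ) => f q.1 * ∏ ν, k ν (q.1 ν) (q.2 ν)) := by
    refine (hfc.measurable.comp measurable_fst).mul (Finset.measurable_prod _ fun ν _ => ?_)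
    exact (hkm ν).comp (Measurable.prodMk (by fun_prop) (by fun_prop))
  have hint : Integrable (Function.uncurry fun t a : Fin r → ℝ => f t * ∏ ν, k ν (t ν) (a ν))
      ((volume : Measure (Fin r → ℝ)).prod (muP r)) := by
    refine (integrable_prod_iff hmeas.aestronglyMeasurable).2 ⟨?_, ?_⟩
    · filter_upwards [ae_ne_zero r] with t ht
      exact (Integrable.fintype_prod (fun ν => (hM ν (t ν) (ht ν)).1)).const_mul _
    · have hI : Integrable fun t : Fin r → ℝ =>
          (C * ∏ ν, |M ν|) * ∏ ν, (|t ν| ^ (σ ν - 1) * Real.exp (-c * |t ν|)) :=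
        (Integrable.fintype_prod (fun ν => integrable_rpow_exp_abs hc (hσ ν))).const_mul _
      refine hI.mono' ?_ ?_
      · exact hmeas.norm.stronglyMeasurable.integral_prod_right.aestronglyMeasurable
      · filter_upwards [ae_ne_zero r] with t ht
        simp only [norm_mul, norm_prod]
        rw [integral_const_mul, integral_fintype_prod_eq_prod (fun ν a => ‖k ν (t ν) a‖)]
        simp_rw [fun ν => (hM ν (t ν) (ht ν)).2]
        rw [norm_mul, norm_prod, norm_norm]
        have hC : 0 ≤ C * ∏ ν, Real.exp (-c * |t ν|) := (norm_nonneg _).trans (hfb t)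
        calc ‖f t‖ * ∏ ν, ‖M ν * |t ν| ^ (σ ν - 1)‖
            ≤ (C * ∏ ν, Real.exp (-c * |t ν|)) * ∏ ν, (|M ν| * |t ν| ^ (σ ν - 1)) := by
              refine mul_le_mul (hfb t) (le_of_eq ?_) (by positivity) hC
              refine Finset.prod_congr rfl fun ν _ => ?_
              rw [norm_mul, Real.norm_eq_abs, Real.norm_eq_abs, abs_of_nonneg (Real.rpow_nonneg (abs_nonneg _) _)]
          _ = _ := by rw [Finset.prod_mul_distrib, Finset.prod_mul_distrib]; ring
  rw [← integral_integral_swap hint]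
  congr 1
  ext t
  rw [integral_const_mul, integral_fintype_prod_eq_prod (fun ν a => k ν (t ν) a)]

/-- Gaussian times a monomial -/
def gs (ε : ℕ) (a ξ : ℝ) : ℂ := (ξ : ℂ) ^ ε * Complex.exp (-((Real.pi * ξ ^ 2 : ℝ) * (a : ℂ)⁻¹))

lemma gs_integrable (ε : ℕ) (a : ℝ) (ha : 0 < a) : Integrable (gs ε a) := by
  have hpi := Real.pi_pos
  have h := integrable_rpow_mul_exp_neg_mul_sq (b := Real.pi * a⁻¹) (by positivity) (s := (ε : ℝ))
    (by have : (0 : ℝ) ≤ ε := Nat.cast_nonneg _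
        linarith)
  refine h.ofReal.congr (Filter.Eventually.of_forall fun ξ => ?_)
  simp only [gs, Real.rpow_natCast]
  change Complex.ofReal (ξ ^ ε * Real.exp (-(Real.pi * a⁻¹) * ξ ^ 2)) = _
  rw [Complex.ofReal_mul, Complex.ofReal_pow, Complex.ofReal_exp]
  congr 2; push_cast; ring

open FourierTransform in
lemma fourier_eq (g : ℝ → ℂ) (t : ℝ) : 𝓕 g t = ∫ ξ : ℝ, g ξ * eC (-(t * ξ : ℝ)) := by
  rw [Real.fourier_real_eq_integral_exp_smul]
  congr 1; ext ξ
  rw [smul_eq_mul, mul_comm]; unfold eC; congr 2; push_cast; ring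

open FourierTransform in
lemma gs_fourier (ε : ℕ) (hε : ε ≤ 1) (a : ℝ) (ha : 0 < a) (t : ℝ) :
    ∫ ξ : ℝ, gs ε a ξ * eC (-(t * ξ : ℝ)) =
      (a : ℂ) ^ (1 / 2 + ε : ℂ) * (-Complex.I) ^ ε * ((t : ℂ) ^ ε * Complex.exp (-((Real.pi * t ^ 2 : ℝ) * a))) := by
  have hac : (a : ℂ) ≠ 0 := by exact_mod_cast ha.ne'
  have hpc : (Real.pi : ℂ) ≠ 0 := by exact_mod_cast Real.pi_pos.ne'
  have hG := fourier_gaussian_pi (b := (a : ℂ)⁻¹) (by rw [← Complex.ofReal_inv, Complex.ofReal_re]; positivity)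
  have hg0 : (fun x : ℝ => Complex.exp (-Real.pi * (a : ℂ)⁻¹ * x ^ 2)) = gs 0 a := by
    ext x; unfold gs; rw [pow_zero, one_mul]; congr 1; push_cast; ring
  have hr : (1 : ℂ) / ((a : ℂ)⁻¹) ^ (1 / 2 : ℂ) = (a : ℂ) ^ (1 / 2 : ℂ) := by
    rw [Complex.inv_cpow, one_div, inv_inv]
    rw [Complex.arg_ofReal_of_nonneg ha.le]; exact Real.pi_pos.ne
  rw [hg0, hr] at hG
  rw [← fourier_eq]
  interval_cases ε
  · rw [hG]
    simp only [pow_zero, Nat.cast_zero, add_zero, mul_one, one_mul]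
    congr 2; push_cast; rw [div_inv_eq_mul]; ring
  · have h1 : Integrable (fun x : ℝ => x • gs 0 a x) := by
      refine (gs_integrable 1 a ha).congr (Filter.Eventually.of_forall fun ξ => ?_)
      simp [gs]
    have hD := congrFun (Real.deriv_fourier (gs_integrable 0 a ha) h1) t
    rw [hG] at hD
    have hd : HasDerivAt (fun t : ℝ => (a : ℂ) ^ (1 / 2 : ℂ) * Complex.exp (-Real.pi / (a : ℂ)⁻¹ * (t : ℂ) ^ 2))
        ((a : ℂ) ^ (1 / 2 : ℂ) * (Complex.exp (-Real.pi / (a : ℂ)⁻¹ * (t : ℂ) ^ 2) * (-Real.pi / (a : ℂ)⁻¹ * (2 * t)))) t := by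
      have h2 : HasDerivAt (fun z : ℂ => (a : ℂ) ^ (1 / 2 : ℂ) * Complex.exp (-Real.pi / (a : ℂ)⁻¹ * z ^ 2))
        ((a : ℂ) ^ (1 / 2 : ℂ) * (Complex.exp (-Real.pi / (a : ℂ)⁻¹ * (t : ℂ) ^ 2) * (-Real.pi / (a : ℂ)⁻¹ * (2 * t)))) (t : ℂ) := by
        have := (((hasDerivAt_pow 2 (t : ℂ)).const_mul (-Real.pi / (a : ℂ)⁻¹)).cexp).const_mul ((a : ℂ) ^ (1 / 2 : ℂ))
        simpa using this
      exact h2.comp_ofReal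
    rw [hd.deriv, fourier_eq] at hD
    have h3 : ∀ ξ : ℝ, (fun x : ℝ => (-2 * Real.pi * Complex.I * x) • gs 0 a x) ξ * eC (-(t * ξ : ℝ)) =
        (-2 * Real.pi * Complex.I) * (gs 1 a ξ * eC (-(t * ξ : ℝ))) := by
      intro ξ; simp only [gs, smul_eq_mul, pow_zero, pow_one, one_mul]; ring
    simp_rw [h3] at hD
    rw [integral_const_mul] at hD
    rw [fourier_eq]
    have h4 : (-2 * Real.pi * Complex.I : ℂ) ≠ 0 := by simp [hpc]
    apply mul_left_cancel₀ h4
    rw [← hD, Nat.cast_one, Complex.cpow_add _ _ hac, Complex.cpow_one, div_inv_eq_mul]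
    have h5 : Complex.exp (-Real.pi * a * (t : ℂ) ^ 2) = Complex.exp (-((Real.pi * t ^ 2 : ℝ) * a)) := by
      congr 1; push_cast; ring
    rw [h5]
    simp only [pow_one]
    ring_nf
    rw [Complex.I_sq]; ring

lemma ExpDecay.integrable {r : ℕ} {f : (Fin r → ℝ) → ℂ} (hf : ExpDecay f) : Integrable f := by
  obtain ⟨hfc, C, c, hc, hfb⟩ := hf
  exact ((Integrable.fintype_prod (fun _ => integrable_exp_abs hc)).const_mul C).mono'
    hfc.aestronglyMeasurable (Filter.Eventually.of_forall hfb)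

lemma eC_sum {r : ℕ} (z : Fin r → ℂ) : eC (∑ ν, z ν) = ∏ ν, eC (z ν) := by
  unfold eC; rw [Finset.mul_sum, Complex.exp_sum]

lemma parseval {r : ℕ} (f g : (Fin r → ℝ) → ℂ) (hf : Integrable f) (hg : Integrable g) :
    ∫ t, f t * ∫ ξ : Fin r → ℝ, g ξ * eC (-(∑ ν, t ν * ξ ν : ℝ)) =
    ∫ ξ, (∫ t : Fin r → ℝ, f t * eC (-(∑ ν, t ν * ξ ν : ℝ))) * g ξ := by
  have hint : Integrable (Function.uncurry fun t ξ : Fin r → ℝ => f t * (g ξ * eC (-(∑ ν, t ν * ξ ν : ℝ))))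
      ((volume : Measure (Fin r → ℝ)).prod volume) := by
    refine (hf.mul_prod hg).mono ?_ ?_
    · have : Continuous fun q : (Fin r → ℝ) × (Fin r → ℝ) => eC (-(∑ ν, q.1 ν * q.2 ν : ℝ)) :=
        cont_eC.comp (by fun_prop)
      refine ((hf.mul_prod hg).aestronglyMeasurable.mul this.aestronglyMeasurable).congr ?_
      exact Filter.Eventually.of_forall fun q => by simp [Function.uncurry, mul_assoc]
    · refine Filter.Eventually.of_forall fun q => le_of_eq ?_
      simp only [Function.uncurry]
      rw [norm_mul, norm_mul, norm_mul, ← Complex.ofReal_neg, norm_eC_real, mul_one]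
  simp_rw [← integral_const_mul, ← integral_mul_const]
  rw [integral_integral_swap hint]
  congr 1; ext ξ; congr 1; ext t; ring

lemma core {r : ℕ} (f : (Fin r → ℝ) → ℂ) (hf : Integrable f) (ε : Fin r → ℕ) (hε : ∀ ν, ε ν ≤ 1)
    (s : Fin r → ℂ) (a : Fin r → ℝ) (ha : ∀ ν, 0 < a ν) :
    ∫ t, f t * ∏ ν, k1 (ε ν) (1 - s ν + ε ν) (t ν) (a ν) =
    (∏ ν, Complex.I ^ (ε ν)) * ∫ ξ : Fin r → ℝ, (∫ t : Fin r → ℝ, f t * eC (-(∑ ν, t ν * ξ ν : ℝ))) *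
      ∏ ν, k2 (ε ν) (s ν + ε ν) (ξ ν) (a ν) := by
  have hP := parseval f (fun ξ => ∏ ν, gs (ε ν) (a ν) (ξ ν)) hf
    (Integrable.fintype_prod fun ν => gs_integrable (ε ν) (a ν) (ha ν))
  have h1 : ∀ t : Fin r → ℝ, ∫ ξ : Fin r → ℝ, (∏ ν, gs (ε ν) (a ν) (ξ ν)) * eC (-(∑ ν, t ν * ξ ν : ℝ)) =
      ∏ ν, ((a ν : ℂ) ^ (1 / 2 + ε ν : ℂ) * (-Complex.I) ^ ε ν *
        ((t ν : ℂ) ^ ε ν * Complex.exp (-((Real.pi * t ν ^ 2 : ℝ) * a ν)))) := by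
    intro t
    simp_rw [← fun ν => gs_fourier (ε ν) (hε ν) (a ν) (ha ν) (t ν)]
    rw [← integral_fintype_prod_volume_eq_prod (fun ν ξ => gs (ε ν) (a ν) ξ * eC (-(t ν * ξ : ℝ)))]
    congr 1; ext ξ
    rw [Finset.prod_mul_distrib, ← eC_sum]
    congr 2; push_cast; rw [Finset.sum_neg_distrib]
  simp_rw [h1] at hP
  have h2 : ∀ t : Fin r → ℝ, ∏ ν, k1 (ε ν) (1 - s ν + ε ν) (t ν) (a ν) =
      (∏ ν, Complex.I ^ (ε ν) * (a ν : ℂ) ^ (-(s ν + ε ν) / 2 - 1)) *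
      ∏ ν, ((a ν : ℂ) ^ (1 / 2 + ε ν : ℂ) * (-Complex.I) ^ ε ν *
        ((t ν : ℂ) ^ ε ν * Complex.exp (-((Real.pi * t ν ^ 2 : ℝ) * a ν)))) := by
    intro t
    rw [← Finset.prod_mul_distrib]
    refine Finset.prod_congr rfl fun ν _ => ?_
    have hac : (a ν : ℂ) ≠ 0 := by exact_mod_cast (ha ν).ne'
    have e1 : (a ν : ℂ) ^ ((1 - s ν + ε ν) / 2 - 1) =
        (a ν : ℂ) ^ (-(s ν + ε ν) / 2 - 1) * (a ν : ℂ) ^ (1 / 2 + ε ν : ℂ) := by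
      rw [← Complex.cpow_add _ _ hac]; congr 1; ring
    have e2 : Complex.I ^ (ε ν) * (-Complex.I) ^ ε ν = 1 := by
      rw [← mul_pow]; simp
    unfold k1
    rw [e1]
    linear_combination (-((t ν : ℂ) ^ ε ν * ((a ν : ℂ) ^ (-(s ν + ε ν) / 2 - 1) * (a ν : ℂ) ^ (1 / 2 + ε ν : ℂ) * Complex.exp (-((Real.pi * t ν ^ 2 : ℝ) * a ν))))) * e2
  have h3 : ∀ ξ : Fin r → ℝ, (∏ ν, k2 (ε ν) (s ν + ε ν) (ξ ν) (a ν)) =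
      (∏ ν, (a ν : ℂ) ^ (-(s ν + ε ν) / 2 - 1)) * ∏ ν, gs (ε ν) (a ν) (ξ ν) := by
    intro ξ
    rw [← Finset.prod_mul_distrib]
    refine Finset.prod_congr rfl fun ν _ => ?_
    unfold k2 gs; ring
  simp_rw [h2, h3]
  simp_rw [mul_left_comm _ (∏ ν, (a ν : ℂ) ^ (-(s ν + ε ν) / 2 - 1)), mul_left_comm (f _)]
  rw [integral_const_mul, integral_const_mul, hP, Finset.prod_mul_distrib]
  ring

lemma tate {r : ℕ} (f fh : (Fin r → ℝ) → ℂ) (hf : ExpDecay f) (hfh : ExpDecay fh)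
    (hF : ∀ ξ, ∫ t : Fin r → ℝ, f t * eC (-(∑ ν, t ν * ξ ν : ℝ)) = fh ξ)
    (ε : Fin r → ℕ) (hε : ∀ ν, ε ν ≤ 1)
    (s : Fin r → ℂ) (hs : ∀ ν, 0 < (s ν).re ∧ (s ν).re < 1) :
    (∏ ν, Complex.Gammaℝ (1 - s ν + ε ν)) *
      ∫ t, f t * ∏ ν, ((t ν : ℂ) ^ ε ν * ((|t ν| : ℝ) : ℂ) ^ (-(1 - s ν + ε ν))) =
    (∏ ν, Complex.I ^ (ε ν)) * ((∏ ν, Complex.Gammaℝ (s ν + ε ν)) *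
      ∫ t, fh t * ∏ ν, ((t ν : ℂ) ^ ε ν * ((|t ν| : ℝ) : ℂ) ^ (-(s ν + ε ν)))) := by
  have hp1 : ∀ ν, 0 < (1 - s ν + ε ν).re := fun ν => by
    have : (0 : ℝ) ≤ ε ν := Nat.cast_nonneg _
    simp; linarith [(hs ν).2]
  have hp2 : ∀ ν, 0 < (s ν + ε ν).re := fun ν => by
    have : (0 : ℝ) ≤ ε ν := Nat.cast_nonneg _
    simp; linarith [(hs ν).1]
  have S1 := swap_lemma f hf (fun ν => k1 (ε ν) (1 - s ν + ε ν)) (fun ν => ε ν - (1 - s ν + ε ν).re + 1)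
    (fun ν => by simp; linarith [(hs ν).1]) (fun ν => good_k1 _ _ (hp1 ν))
  have S2 := swap_lemma fh hfh (fun ν => k2 (ε ν) (s ν + ε ν)) (fun ν => ε ν - (s ν + ε ν).re + 1)
    (fun ν => by simp; linarith [(hs ν).2]) (fun ν => good_k2 _ _ (hp2 ν))
  have L1 : ∫ t, f t * ∏ ν, (∫ a in Set.Ioi (0 : ℝ), k1 (ε ν) (1 - s ν + ε ν) (t ν) a) =
      (∏ ν, Complex.Gammaℝ (1 - s ν + ε ν)) *
      ∫ t, f t * ∏ ν, ((t ν : ℂ) ^ ε ν * ((|t ν| : ℝ) : ℂ) ^ (-(1 - s ν + ε ν))) := by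
    rw [← integral_const_mul]
    apply integral_congr_ae
    filter_upwards [ae_ne_zero r] with t ht
    simp_rw [fun ν => int_k1 (ε ν) _ (hp1 ν) (t ν) (ht ν)]
    rw [Finset.prod_mul_distrib]; ring
  have L2 : ∫ t, fh t * ∏ ν, (∫ a in Set.Ioi (0 : ℝ), k2 (ε ν) (s ν + ε ν) (t ν) a) =
      (∏ ν, Complex.Gammaℝ (s ν + ε ν)) *
      ∫ t, fh t * ∏ ν, ((t ν : ℂ) ^ ε ν * ((|t ν| : ℝ) : ℂ) ^ (-(s ν + ε ν))) := by
    rw [← integral_const_mul]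
    apply integral_congr_ae
    filter_upwards [ae_ne_zero r] with t ht
    simp_rw [fun ν => int_k2 (ε ν) _ (hp2 ν) (t ν) (ht ν)]
    rw [Finset.prod_mul_distrib]; ring
  rw [← L1, ← L2, S1, S2, ← integral_const_mul]
  apply integral_congr_ae
  have hpos : ∀ᵐ a ∂(muP r), ∀ ν, 0 < a ν := by
    rw [ae_all_iff]; intro ν
    have h1 : ∀ᵐ b ∂(volume.restrict (Set.Ioi (0 : ℝ))), 0 < b := ae_restrict_mem measurableSet_Ioi
    exact (Measure.tendsto_eval_ae_ae (μ := fun _ : Fin r => volume.restrict (Set.Ioi (0 : ℝ))) (i := ν)).eventually h1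
  filter_upwards [hpos] with a ha
  rw [core f hf.integrable ε hε s a ha]
  simp_rw [hF]

lemma exists_lower {r : ℕ} (m : Fin r → ℝ) (hm : ∀ ν, 0 < m ν) : ∃ c, 0 < c ∧ ∀ ν, c ≤ m ν := by
  have hS : 0 ≤ ∑ ν, (m ν)⁻¹ := Finset.sum_nonneg fun ν _ => (inv_pos.2 (hm ν)).le
  refine ⟨(∑ ν, (m ν)⁻¹ + 1)⁻¹, by positivity, fun ν => ?_⟩
  refine inv_le_of_inv_le₀ (hm ν) ?_
  have := Finset.single_le_sum (f := fun ν => (m ν)⁻¹) (fun ν _ => (inv_pos.2 (hm ν)).le) (Finset.mem_univ ν)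
  linarith

lemma linear_lower {r : ℕ} (A : Matrix (Fin r) (Fin r) ℝ) (hA : A.det ≠ 0) :
    ∃ K : ℝ, 0 < K ∧ ∀ t : Fin r → ℝ, ∑ ν, |t ν| ≤ K * ∑ ν, |Matrix.vecMul t A ν| := by
  refine ⟨1 + ∑ ν, ∑ μ, |A⁻¹ ν μ|, ?_, fun t => ?_⟩
  · have : 0 ≤ ∑ ν, ∑ μ, |A⁻¹ ν μ| := Finset.sum_nonneg fun _ _ => Finset.sum_nonneg fun _ _ => abs_nonneg _
    linarith
  · set u := Matrix.vecMul t A with hu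
    have ht : t = Matrix.vecMul u A⁻¹ := by
      rw [hu, Matrix.vecMul_vecMul, Matrix.mul_nonsing_inv _ (isUnit_iff_ne_zero.2 hA), Matrix.vecMul_one]
    have h1 : ∑ μ, |t μ| ≤ ∑ μ, ∑ ν, |u ν| * |A⁻¹ ν μ| := by
      refine Finset.sum_le_sum fun μ _ => ?_
      conv_lhs => rw [ht]
      simp only [Matrix.vecMul, dotProduct]
      refine (Finset.abs_sum_le_sum_abs _ _).trans (le_of_eq ?_)
      simp_rw [abs_mul]
    refine h1.trans ?_
    rw [Finset.sum_comm, Finset.mul_sum]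
    refine Finset.sum_le_sum fun ν _ => ?_
    rw [← Finset.mul_sum, mul_comm]
    refine mul_le_mul_of_nonneg_right ?_ (abs_nonneg _)
    have := Finset.single_le_sum (f := fun ν => ∑ μ, |A⁻¹ ν μ|)
      (fun ν _ => Finset.sum_nonneg fun _ _ => abs_nonneg _) (Finset.mem_univ ν)
    linarith

lemma FF_decay {r : ℕ} (A : Matrix (Fin r) (Fin r) ℝ) (hA : A.det ≠ 0) (x y : Fin r → ℝ)
    (hx : ∀ ν, 0 < x ν ∧ x ν < 1) (hy : ∀ ν, 0 < y ν ∧ y ν < 1) :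
    ExpDecay (fun t : Fin r → ℝ => FF (Matrix.vecMul t A) x y) := by
  constructor
  · unfold FF
    refine continuous_finsetProd _ fun ν _ => ?_
    refine (phiF_cont (x ν) (y ν) (hy ν).1 (hy ν).2).comp ?_
    simp only [Matrix.vecMul, dotProduct]
    fun_prop
  · obtain ⟨c, hc, hcm⟩ := exists_lower (fun ν => 2 * Real.pi * min (x ν) (1 - x ν)) fun ν => by
      have := Real.pi_pos
      have : 0 < min (x ν) (1 - x ν) := lt_min (hx ν).1 (by linarith [(hx ν).2])
      positivity
    obtain ⟨K, hK, hKt⟩ := linear_lower A hA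
    refine ⟨∏ ν, (Real.sin (Real.pi * y ν))⁻¹, c / K, by positivity, fun t => ?_⟩
    unfold FF
    rw [norm_prod]
    have hs : ∀ ν, 0 < Real.sin (Real.pi * y ν) := fun ν => sin_pos_of_Ioo (hy ν).1 (hy ν).2
    have h1 : ∏ ν, ‖phiF (Matrix.vecMul t A ν) (x ν) (y ν)‖ ≤
        ∏ ν, ((Real.sin (Real.pi * y ν))⁻¹ * Real.exp (-c * |Matrix.vecMul t A ν|)) := by
      refine Finset.prod_le_prod (fun _ _ => norm_nonneg _) fun ν _ => ?_
      refine (phiF_bound _ _ _ (hx ν).1 (hx ν).2 (hy ν).1 (hy ν).2).trans ?_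
      refine mul_le_mul_of_nonneg_left ?_ (inv_pos.2 (hs ν)).le
      refine Real.exp_le_exp.2 ?_
      exact mul_le_mul_of_nonneg_right (neg_le_neg (hcm ν)) (abs_nonneg _)
    refine h1.trans ?_
    rw [Finset.prod_mul_distrib]
    refine mul_le_mul_of_nonneg_left ?_ (Finset.prod_nonneg fun ν _ => (inv_pos.2 (hs ν)).le)
    rw [← Real.exp_sum, ← Real.exp_sum]
    refine Real.exp_le_exp.2 ?_
    rw [← Finset.mul_sum, ← Finset.mul_sum]
    have := hKt t
    have h2 : c / K * ∑ ν, |t ν| ≤ c / K * (K * ∑ ν, |Matrix.vecMul t A ν|) :=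
      mul_le_mul_of_nonneg_left this (by positivity)
    rw [← mul_assoc, div_mul_cancel₀ _ hK.ne'] at h2
    linarith

lemma ExpDecay.const_mul_neg {r : ℕ} {f : (Fin r → ℝ) → ℂ} (hf : ExpDecay f) (k : ℂ) :
    ExpDecay (fun t => k * f (-t)) := by
  obtain ⟨hfc, C, c, hc, hfb⟩ := hf
  refine ⟨by fun_prop, ‖k‖ * C, c, hc, fun t => ?_⟩
  rw [norm_mul, mul_assoc]
  refine mul_le_mul_of_nonneg_left ?_ (norm_nonneg _)
  simpa using hfb (-t)

lemma FF_fourier {r : ℕ} (A : Matrix (Fin r) (Fin r) ℝ) (hA : A.det ≠ 0) (x y : Fin r → ℝ)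
    (hx : ∀ ν, 0 < x ν ∧ x ν < 1) (hy : ∀ ν, 0 < y ν ∧ y ν < 1) (ξ : Fin r → ℝ) :
    ∫ t : Fin r → ℝ, FF (Matrix.vecMul t A) x y * eC (-(∑ ν, t ν * ξ ν : ℝ)) =
      ((|A.det|⁻¹ : ℝ) * (∏ ν : Fin r, Complex.I * eC (-(x ν * y ν : ℝ)))) *
        FF (Matrix.vecMul (-ξ) A.transpose⁻¹) y (fun ν => 1 - x ν) := by
  have hM : A.transpose.det ≠ 0 := by rwa [Matrix.det_transpose]
  set η := Matrix.vecMul ξ A.transpose⁻¹ with hη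
  have hg : ∀ t : Fin r → ℝ, FF (Matrix.vecMul t A) x y * eC (-(∑ ν, t ν * ξ ν : ℝ)) =
      (fun u : Fin r → ℝ => ∏ ν, (phiF (u ν) (x ν) (y ν) * eC (-(u ν * η ν : ℝ)))) (Matrix.toLin' A.transpose t) := by
    intro t
    have e1 : Matrix.toLin' A.transpose t = Matrix.vecMul t A := by
      rw [Matrix.toLin'_apply, Matrix.mulVec_transpose]
    have e2 : ∑ ν, t ν * ξ ν = ∑ ν, Matrix.vecMul t A ν * η ν := by
      change dotProduct t ξ = dotProduct (Matrix.vecMul t A) η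
      rw [← Matrix.dotProduct_mulVec, hη, ← Matrix.mulVec_transpose, Matrix.mulVec_mulVec,
        Matrix.transpose_nonsing_inv, Matrix.transpose_transpose,
        Matrix.mul_nonsing_inv _ (isUnit_iff_ne_zero.2 hA), Matrix.one_mulVec]
    simp only
    rw [e1, e2, Finset.prod_mul_distrib, ← eC_sum]
    unfold FF
    congr 2; push_cast; rw [Finset.sum_neg_distrib]
  simp_rw [hg]
  have hemb : MeasurableEmbedding (Matrix.toLin' A.transpose) := by
    have := (LinearEquiv.ofIsUnitDet (f := Matrix.toLin' A.transpose)
      (v := Pi.basisFun ℝ (Fin r)) (v' := Pi.basisFun ℝ (Fin r)) (by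
        rw [LinearMap.toMatrix_eq_toMatrix', LinearMap.toMatrix'_toLin']; exact isUnit_iff_ne_zero.2 hM)).toContinuousLinearEquiv.toHomeomorph.measurableEmbedding
    exact this
  rw [← hemb.integral_map (μ := volume) (g := fun u : Fin r → ℝ => ∏ ν, (phiF (u ν) (x ν) (y ν) * eC (-(u ν * η ν : ℝ)))), Real.map_matrix_volume_pi_eq_smul_volume_pi hM, integral_smul_measure,
    integral_fintype_prod_volume_eq_prod (fun ν u => phiF u (x ν) (y ν) * eC (-(u * η ν : ℝ)))]
  simp_rw [fun ν => phi_fourier (x ν) (y ν) (η ν) (hx ν).1 (hx ν).2 (hy ν).1 (hy ν).2]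
  rw [Finset.prod_mul_distrib, ENNReal.toReal_ofReal (abs_nonneg _), Matrix.det_transpose, abs_inv,
    Complex.real_smul, mul_assoc]
  congr 2
  unfold FF
  rw [Matrix.neg_vecMul]
  rfl

lemma one_dim (χ : ℕ) (hχ : χ ≤ 1) (s : ℂ) (t : ℝ) (ht : t ≠ 0) :
    (Real.sign t : ℂ) ^ χ * ((|t| : ℝ) : ℂ) ^ s * (t : ℂ)⁻¹ =
      (t : ℂ) ^ (1 - χ) * ((|t| : ℝ) : ℂ) ^ (-(1 - s + ((1 - χ : ℕ) : ℂ))) := by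
  have htc : (t : ℂ) ≠ 0 := by exact_mod_cast ht
  have hat : ((|t| : ℝ) : ℂ) ≠ 0 := by exact_mod_cast (abs_pos.2 ht).ne'
  interval_cases χ
  · have : -(1 - s + ((1 - 0 : ℕ) : ℂ)) = s - 2 := by push_cast; ring
    rw [this, Complex.cpow_sub _ _ hat, Complex.cpow_ofNat, ← Complex.ofReal_pow |t| 2, sq_abs]
    push_cast
    simp only [pow_zero, one_mul, Nat.sub_zero, pow_one]
    field_simp
  · have : -(1 - s + ((1 - 1 : ℕ) : ℂ)) = s - 1 := by push_cast; ring
    rw [this, Complex.cpow_sub _ _ hat, Complex.cpow_one]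
    simp only [Nat.sub_self, pow_zero, one_mul, pow_one]
    rcases lt_or_gt_of_ne ht with h | h
    · rw [Real.sign_of_neg h, abs_of_neg h]; push_cast; field_simp
    · rw [Real.sign_of_pos h, abs_of_pos h]; push_cast; field_simp

lemma Lchi_int {r : ℕ} (χ : Fin r → ℕ) (hχ : ∀ ν, χ ν ≤ 1) (s : Fin r → ℂ)
    (A : Matrix (Fin r) (Fin r) ℝ) (x y : Fin r → ℝ) :
    ∫ t : Fin r → ℝ, FF (Matrix.vecMul t A) x y * qchar χ s t * ∏ ν, ((t ν : ℝ) : ℂ)⁻¹ =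
    ∫ t : Fin r → ℝ, FF (Matrix.vecMul t A) x y *
      ∏ ν, ((t ν : ℂ) ^ (1 - χ ν) * ((|t ν| : ℝ) : ℂ) ^ (-(1 - s ν + ((1 - χ ν : ℕ) : ℂ)))) := by
  apply integral_congr_ae
  filter_upwards [ae_ne_zero r] with t ht
  unfold qchar
  rw [mul_assoc, ← Finset.prod_mul_distrib]
  congr 1
  exact Finset.prod_congr rfl fun ν _ => one_dim (χ ν) (hχ ν) (s ν) (t ν) (ht ν)

lemma gamma_ratio {r : ℕ} (χ : Fin r → ℕ) (hχ : ∀ ν, χ ν ≤ 1) (s : Fin r → ℂ) (hs : ∀ ν, 0 < (s ν).re) :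
    GammaChi χ s * (∏ ν, GammaC (s ν))⁻¹ = (∏ ν, Complex.Gammaℝ (s ν + ((1 - χ ν : ℕ) : ℂ)))⁻¹ := by
  unfold GammaChi
  rw [← Finset.prod_inv_distrib, ← Finset.prod_inv_distrib, ← Finset.prod_mul_distrib]
  refine Finset.prod_congr rfl fun ν _ => ?_
  have h1 : GammaC (s ν) = Complex.Gammaℝ (s ν) * Complex.Gammaℝ (s ν + 1) :=
    (Complex.Gammaℝ_mul_Gammaℝ_add_one (s ν)).symm
  have h2 : ∀ z, GammaR z = Complex.Gammaℝ z := fun z => rfl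
  have n1 : Complex.Gammaℝ (s ν) ≠ 0 := Complex.Gammaℝ_ne_zero_of_re_pos (hs ν)
  have n2 : Complex.Gammaℝ (s ν + 1) ≠ 0 := Complex.Gammaℝ_ne_zero_of_re_pos (by simp; linarith [hs ν])
  rw [h1, h2]
  have : χ ν = 0 ∨ χ ν = 1 := by have := hχ ν; omega
  rcases this with h | h <;> rw [h] <;> simp <;> field_simp

lemma main_eq {r : ℕ} (χ : Fin r → ℕ) (hχ : ∀ ν, χ ν ≤ 1)
    (A : Matrix (Fin r) (Fin r) ℝ) (hA : A.det ≠ 0) (x y : Fin r → ℝ)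
    (hx : ∀ ν, 0 < x ν ∧ x ν < 1) (hy : ∀ ν, 0 < y ν ∧ y ν < 1)
    (s : Fin r → ℂ) (hs : ∀ ν, 0 < (s ν).re ∧ (s ν).re < 1) :
    ((Real.sqrt |A.det| : ℝ) : ℂ) * GammaChi χ s * ShintaniLchi χ s A x y =
        Complex.I ^ (∑ ν, χ ν) * eC (-((∑ ν, x ν * y ν : ℝ) : ℂ)) *
          ((Real.sqrt |A.det| : ℝ) : ℂ)⁻¹ * GammaChi χ (fun ν => 1 - s ν) *
          ShintaniLchi χ (fun ν => 1 - s ν) A.transpose⁻¹ y (fun ν => 1 - x ν) := by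
  have hx' : ∀ ν, 0 < (fun ν => 1 - x ν) ν ∧ (fun ν => 1 - x ν) ν < 1 := fun ν => by
    constructor <;> simp only <;> linarith [(hx ν).1, (hx ν).2]
  have hA' : A.transpose⁻¹.det ≠ 0 := by
    rw [Matrix.det_nonsing_inv, Ring.inverse_eq_inv', Matrix.det_transpose]
    exact inv_ne_zero hA
  set K : ℂ := ((|A.det|⁻¹ : ℝ) * (∏ ν : Fin r, Complex.I * eC (-(x ν * y ν : ℝ)))) with hK
  set g : (Fin r → ℝ) → ℂ := fun t => FF (Matrix.vecMul t A.transpose⁻¹) y (fun ν => 1 - x ν) with hg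
  have T := tate (fun t => FF (Matrix.vecMul t A) x y) (fun t => K * g (-t))
    (FF_decay A hA x y hx hy) ((FF_decay _ hA' y _ hy hx').const_mul_neg K)
    (FF_fourier A hA x y hx hy) (fun ν => 1 - χ ν) (fun ν => Nat.sub_le _ _) s hs
  have hJ : ∫ t : Fin r → ℝ, (K * g (-t)) * ∏ ν, ((t ν : ℂ) ^ (1 - χ ν) * ((|t ν| : ℝ) : ℂ) ^ (-(s ν + ((1 - χ ν : ℕ) : ℂ)))) =
      K * (∏ ν : Fin r, (-1 : ℂ) ^ (1 - χ ν)) * ∫ t : Fin r → ℝ, g t * ∏ ν, ((t ν : ℂ) ^ (1 - χ ν) * ((|t ν| : ℝ) : ℂ) ^ (-(s ν + ((1 - χ ν : ℕ) : ℂ)))) := by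
    rw [← integral_neg_eq_self, ← integral_const_mul]
    congr 1; ext t
    have : ∏ ν, ((((-t) ν : ℝ) : ℂ) ^ (1 - χ ν) * ((|(-t) ν| : ℝ) : ℂ) ^ (-(s ν + ((1 - χ ν : ℕ) : ℂ)))) =
        (∏ ν : Fin r, (-1 : ℂ) ^ (1 - χ ν)) * ∏ ν, ((t ν : ℂ) ^ (1 - χ ν) * ((|t ν| : ℝ) : ℂ) ^ (-(s ν + ((1 - χ ν : ℕ) : ℂ)))) := by
      rw [← Finset.prod_mul_distrib]
      refine Finset.prod_congr rfl fun ν _ => ?_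
      rw [Pi.neg_apply, abs_neg, Complex.ofReal_neg, neg_pow, mul_assoc]
    rw [this, neg_neg]; ring
  rw [hJ] at T
  have hI : (∏ ν : Fin r, Complex.I ^ (1 - χ ν)) * (K * ∏ ν : Fin r, (-1 : ℂ) ^ (1 - χ ν)) =
      (|A.det|⁻¹ : ℝ) * (Complex.I ^ (∑ ν, χ ν) * eC (-((∑ ν, x ν * y ν : ℝ) : ℂ))) := by
    have e1 : eC (-((∑ ν, x ν * y ν : ℝ) : ℂ)) = ∏ ν, eC (-(x ν * y ν : ℝ)) := by
      rw [← eC_sum, Finset.sum_neg_distrib]; congr 2; push_cast; rfl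
    have e2 : Complex.I ^ (∑ ν, χ ν) = (∏ ν : Fin r, Complex.I ^ (1 - χ ν)) * (∏ ν : Fin r, (-1 : ℂ) ^ (1 - χ ν)) * ∏ ν : Fin r, Complex.I := by
      rw [← Finset.prod_pow_eq_pow_sum, ← Finset.prod_mul_distrib, ← Finset.prod_mul_distrib]
      refine Finset.prod_congr rfl fun ν _ => ?_
      have : χ ν = 0 ∨ χ ν = 1 := by have := hχ ν; omega
      rcases this with h | h <;> rw [h] <;> simp
    rw [e1, e2, hK, Finset.prod_mul_distrib]; ring
  have R1 := gamma_ratio χ hχ s fun ν => (hs ν).1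
  have R2 := gamma_ratio χ hχ (fun ν => 1 - s ν) fun ν => by simp; linarith [(hs ν).2]
  unfold ShintaniLchi
  rw [Lchi_int χ hχ, Lchi_int χ hχ]
  simp only [sub_sub_cancel]
  set J1 := ∫ t : Fin r → ℝ, FF (Matrix.vecMul t A) x y *
      ∏ ν, ((t ν : ℂ) ^ (1 - χ ν) * ((|t ν| : ℝ) : ℂ) ^ (-(1 - s ν + ((1 - χ ν : ℕ) : ℂ)))) with hJ1
  set J2 := ∫ t : Fin r → ℝ, g t * ∏ ν, ((t ν : ℂ) ^ (1 - χ ν) * ((|t ν| : ℝ) : ℂ) ^ (-(s ν + ((1 - χ ν : ℕ) : ℂ)))) with hJ2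
  set P1 := ∏ ν, Complex.Gammaℝ (1 - s ν + ((1 - χ ν : ℕ) : ℂ)) with hP1
  set P2 := ∏ ν, Complex.Gammaℝ (s ν + ((1 - χ ν : ℕ) : ℂ)) with hP2
  have n1 : P1 ≠ 0 := Finset.prod_ne_zero_iff.2 fun ν _ => Complex.Gammaℝ_ne_zero_of_re_pos (by
    have : (0 : ℝ) ≤ (1 - χ ν : ℕ) := Nat.cast_nonneg _
    rw [Complex.add_re, Complex.natCast_re, Complex.sub_re, Complex.one_re]; linarith [(hs ν).2])
  have n2 : P2 ≠ 0 := Finset.prod_ne_zero_iff.2 fun ν _ => Complex.Gammaℝ_ne_zero_of_re_pos (by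
    have : (0 : ℝ) ≤ (1 - χ ν : ℕ) := Nat.cast_nonneg _
    rw [Complex.add_re, Complex.natCast_re]; linarith [(hs ν).1])
  set q : ℂ := ((Real.sqrt |A.det| : ℝ) : ℂ) with hq
  have hqn : q ≠ 0 := by
    rw [hq, Complex.ofReal_ne_zero]; exact (Real.sqrt_pos.2 (abs_pos.2 hA)).ne'
  have hd : ((|A.det|⁻¹ : ℝ) : ℂ) = q⁻¹ * q⁻¹ := by
    rw [hq, ← Complex.ofReal_inv, ← Complex.ofReal_mul, ← mul_inv, Real.mul_self_sqrt (abs_nonneg _)]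
  rw [hd] at hI
  set W := Complex.I ^ (∑ ν, χ ν) * eC (-((∑ ν, x ν * y ν : ℝ) : ℂ)) with hW
  have T' : P1 * J1 = P2 * (q⁻¹ * q⁻¹ * W) * J2 := by
    rw [T, ← hI]; ring
  have hJ1' : J1 = P1⁻¹ * (P2 * (q⁻¹ * q⁻¹ * W) * J2) := by
    rw [← T', inv_mul_cancel_left₀ n1]
  calc _ = q * (GammaChi χ s * (∏ ν, GammaC (s ν))⁻¹) * J1 := by ring
    _ = q * P2⁻¹ * (P1⁻¹ * (P2 * (q⁻¹ * q⁻¹ * W) * J2)) := by rw [R1, ← hJ1']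
    _ = W * q⁻¹ * P1⁻¹ * J2 := by field_simp
    _ = W * q⁻¹ * (GammaChi χ (fun ν => 1 - s ν) * (∏ ν, GammaC (1 - s ν))⁻¹) * J2 := by rw [R2]
    _ = _ := by ring

theorem stmt_12 (r : ℕ) (hr : 1 ≤ r) (χ : Fin r → ℕ) (hχ : ∀ ν, χ ν ≤ 1)
    (A : Matrix (Fin r) (Fin r) ℝ) (hA : A.det ≠ 0) (x y : Fin r → ℝ)
    (hx : ∀ ν, x ν ∉ Set.range ((↑) : ℤ → ℝ))
    (hy : ∀ ν, y ν ∉ Set.range ((↑) : ℤ → ℝ)) :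
    (∀ s : Fin r → ℂ, (∀ ν, 0 < (s ν).re) → ∀ k l : Fin r → ℤ,
      ShintaniLchiExt χ s A (fun ν => x ν + (k ν : ℝ)) (fun ν => y ν + (l ν : ℝ)) =
        eC (-((∑ ν, (k ν : ℝ) * y ν : ℝ) : ℂ)) * ShintaniLchiExt χ s A x y) ∧
    (∀ s : Fin r → ℂ, (∀ ν, 0 < (s ν).re ∧ (s ν).re < 1) →
      ((Real.sqrt |A.det| : ℝ) : ℂ) * GammaChi χ s * ShintaniLchiExt χ s A x y =
        Complex.I ^ (∑ ν, χ ν) * eC (-((∑ ν, x ν * y ν : ℝ) : ℂ)) *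
          ((Real.sqrt |A.det| : ℝ) : ℂ)⁻¹ * GammaChi χ (fun ν => 1 - s ν) *
          ShintaniLchiExt χ (fun ν => 1 - s ν) A.transpose⁻¹ y (fun ν => 1 - x ν)) := by
  have hfr : ∀ z : ℝ, z ∉ Set.range ((↑) : ℤ → ℝ) → 0 < Int.fract z ∧ Int.fract z < 1 := by
    intro z hz
    refine ⟨Int.fract_pos.2 fun h => hz ⟨_, h.symm⟩, Int.fract_lt_one _⟩
  refine ⟨fun s hs k l => ?_, fun s hs => ?_⟩
  · unfold ShintaniLchiExt
    simp only [Int.fract_add_intCast, Int.floor_add_intCast]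
    rw [← mul_assoc, ← eC_add]
    congr 1
    have : (-((∑ ν, (((⌊x ν⌋ + k ν : ℤ)) : ℝ) * (y ν + l ν) : ℝ) : ℂ)) =
        (-((∑ ν, (k ν : ℝ) * y ν : ℝ) : ℂ)) + (-((∑ ν, (⌊x ν⌋ : ℝ) * y ν : ℝ) : ℂ)) +
        ((-(∑ ν, (⌊x ν⌋ + k ν) * l ν) : ℤ) : ℂ) := by
      push_cast
      rw [← Finset.sum_neg_distrib, ← Finset.sum_neg_distrib, ← Finset.sum_neg_distrib,
        ← Finset.sum_neg_distrib, ← Finset.sum_add_distrib, ← Finset.sum_add_distrib]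
      exact Finset.sum_congr rfl fun ν _ => by ring
    rw [this, eC_add, eC_int, mul_one]
  · have hM := main_eq χ hχ A hA (fun ν => Int.fract (x ν)) (fun ν => Int.fract (y ν))
      (fun ν => hfr _ (hx ν)) (fun ν => hfr _ (hy ν)) s hs
    unfold ShintaniLchiExt
    have h1 : (fun ν => Int.fract (1 - x ν)) = fun ν => 1 - Int.fract (x ν) := by
      ext ν
      rw [Int.fract_eq_iff]
      refine ⟨by linarith [(hfr _ (hx ν)).2], by linarith [(hfr _ (hx ν)).1], -⌊x ν⌋, ?_⟩
      have := Int.floor_add_fract (x ν)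
      push_cast; linarith
    rw [h1]
    have h2 : eC (-((∑ ν, x ν * y ν : ℝ) : ℂ)) * eC (-((∑ ν, (⌊y ν⌋ : ℝ) * (1 - x ν) : ℝ) : ℂ)) =
        eC (-((∑ ν, (⌊x ν⌋ : ℝ) * y ν : ℝ) : ℂ)) * eC (-((∑ ν, Int.fract (x ν) * Int.fract (y ν) : ℝ) : ℂ)) := by
      have : (-((∑ ν, x ν * y ν : ℝ) : ℂ)) + (-((∑ ν, (⌊y ν⌋ : ℝ) * (1 - x ν) : ℝ) : ℂ)) =
          (-((∑ ν, (⌊x ν⌋ : ℝ) * y ν : ℝ) : ℂ)) + (-((∑ ν, Int.fract (x ν) * Int.fract (y ν) : ℝ) : ℂ)) +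
          ((∑ ν, (⌊x ν⌋ * ⌊y ν⌋ - ⌊y ν⌋) : ℤ) : ℂ) := by
        rw [← Complex.ofReal_intCast]
        simp only [← Complex.ofReal_neg, ← Complex.ofReal_add]
        congr 1
        push_cast
        rw [← Finset.sum_neg_distrib, ← Finset.sum_neg_distrib, ← Finset.sum_neg_distrib,
          ← Finset.sum_neg_distrib, ← Finset.sum_add_distrib, ← Finset.sum_add_distrib, ← Finset.sum_add_distrib]
        refine Finset.sum_congr rfl fun ν _ => ?_
        unfold Int.fract
        ring
      rw [← eC_add, this, eC_add, eC_int, mul_one, eC_add]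
    linear_combination (eC (-((∑ ν, (⌊x ν⌋ : ℝ) * y ν : ℝ) : ℂ))) * hM -
      (Complex.I ^ (∑ ν, χ ν) * ((Real.sqrt |A.det| : ℝ) : ℂ)⁻¹ * GammaChi χ (fun ν => 1 - s ν) *
          ShintaniLchi χ (fun ν => 1 - s ν) A.transpose⁻¹ (fun ν => Int.fract (y ν)) (fun ν => 1 - Int.fract (x ν))) * h2

end
end

section
/- Let r ≥ 1, χ : {1,…,r} → {0,1}, A = (a_{μν}) ∈ GL_r(ℝ), y ∈ (0,1)^r, and s ∈ ℂ^r with Re s_ν > 0 for every ν. Then for each ν ∈ {1,…,r}, the function x ↦ L_χ(s, A, x, y) on (0,1)^r is differentiable in x_ν and ∂/∂x_ν L_χ(s, A, x, y) = −Σ_{μ=1}^r a_{μν} s_μ L_{χ+1_μ}(s+1_μ, A, x, y), where χ+1_μ is the parity type obtained from χ by flipping its value at μ (mod 2), and s+1_μ adds 1 to the μ-th coordinate of s. -/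
open MeasureTheory

noncomputable section

theorem aux_norm_eC_real (y : ℝ) : ‖eC (y : ℂ)‖ = 1 := by
  unfold eC
  rw [Complex.norm_exp]
  simp

theorem aux_eC_ne_one (y : ℝ) (hy : y ∈ Set.Ioo (0 : ℝ) 1) : eC (y : ℂ) ≠ 1 := by
  unfold eC
  intro h
  rw [Complex.exp_eq_one_iff] at h
  obtain ⟨n, hn⟩ := h
  have h2 : (2 * Real.pi * Complex.I : ℂ) ≠ 0 := Complex.two_pi_I_ne_zero
  have h3 : (y : ℂ) = (n : ℂ) := by
    apply mul_left_cancel₀ h2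
    rw [hn]; ring
  have h4 : y = (n : ℝ) := by exact_mod_cast h3
  rw [h4] at hy
  have h5 : (0 : ℤ) < n := by exact_mod_cast hy.1
  have h6 : n < (1 : ℤ) := by exact_mod_cast hy.2
  omega

theorem aux_denom (z : ℂ) (hz : ‖z‖ = 1) (q : ℝ) (hq : 0 ≤ q) :
    ‖1 - z‖ / 2 ≤ ‖1 - z * q‖ ∧ (1 ≤ q → q * (‖1 - z‖ / 2) ≤ ‖1 - z * q‖) := by
  have hzq : ‖z * q‖ = q := by rw [norm_mul, hz, Complex.norm_real, Real.norm_of_nonneg hq, one_mul]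
  have h1 : |1 - q| ≤ ‖1 - z * q‖ := by
    have := abs_norm_sub_norm_le (1 : ℂ) (z * q)
    rwa [hzq, norm_one] at this
  have h2 : ‖1 - z‖ ≤ ‖1 - z * q‖ + |1 - q| := by
    have e : (1 - z : ℂ) = (1 - z * q) - z * ((1 - q : ℝ) : ℂ) := by push_cast; ring
    calc ‖1 - z‖ = ‖(1 - z * q) - z * ((1 - q : ℝ) : ℂ)‖ := by rw [← e]
      _ ≤ ‖1 - z * q‖ + ‖z * ((1 - q : ℝ) : ℂ)‖ := norm_sub_le _ _
      _ = _ := by rw [norm_mul, hz, Complex.norm_real, one_mul, Real.norm_eq_abs]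
  refine ⟨by linarith, fun hq1 => ?_⟩
  have h3 : q * ‖1 - z‖ ≤ ‖1 - z * q‖ + |1 - q| := by
    have e : (q : ℂ) * (1 - z) = (1 - z * q) - ((1 - q : ℝ) : ℂ) := by push_cast; ring
    calc q * ‖1 - z‖ = ‖(q : ℂ) * (1 - z)‖ := by
          rw [norm_mul, Complex.norm_real, Real.norm_of_nonneg hq]
      _ = ‖(1 - z * q) - ((1 - q : ℝ) : ℂ)‖ := by rw [e]
      _ ≤ ‖1 - z * q‖ + ‖((1 - q : ℝ) : ℂ)‖ := norm_sub_le _ _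
      _ = _ := by rw [Complex.norm_real, Real.norm_eq_abs]
  linarith

theorem aux_num (t x : ℝ) :
    eC (Complex.I * t * x) = ((Real.exp (-(2 * Real.pi * t * x)) : ℝ) : ℂ) := by
  unfold eC
  push_cast
  congr 1
  linear_combination (2 * Real.pi * t * x : ℂ) * Complex.I_mul_I

theorem aux_den (t y : ℝ) :
    eC (y + Complex.I * t) = eC y * ((Real.exp (-(2 * Real.pi * t)) : ℝ) : ℂ) := by
  unfold eC
  push_cast
  rw [← Complex.exp_add]
  congr 1
  linear_combination (2 * Real.pi * t : ℂ) * Complex.I_mul_I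

theorem aux_phi_bound (y : ℝ) (hy : y ∈ Set.Ioo (0 : ℝ) 1) (ε x : ℝ) (h1 : ε ≤ x)
    (h2 : ε ≤ 1 - x) (t : ℝ) :
    ‖phiF t x y‖ ≤ (2 / ‖1 - eC (y : ℂ)‖) * Real.exp (-(2 * Real.pi * ε * |t|)) := by
  have hpos : 0 < ‖1 - eC (y : ℂ)‖ := by
    rw [norm_pos_iff, sub_ne_zero]
    exact (aux_eC_ne_one y hy).symm
  have hpi := Real.pi_pos
  unfold phiF
  rw [norm_div, aux_num, aux_den, Complex.norm_real, Real.norm_of_nonneg (Real.exp_pos _).le]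
  have hd := aux_denom _ (aux_norm_eC_real y) (Real.exp (-(2 * Real.pi * t)))
    (Real.exp_pos _).le
  rcases le_or_gt 0 t with ht | ht
  · rw [abs_of_nonneg ht]
    have hle : Real.exp (-(2 * Real.pi * t * x)) ≤ Real.exp (-(2 * Real.pi * ε * t)) := by
      rw [Real.exp_le_exp]
      have : 0 ≤ (2 * Real.pi * t) * (x - ε) := mul_nonneg (by positivity) (by linarith)
      nlinarith
    calc _ ≤ Real.exp (-(2 * Real.pi * ε * t)) / (‖1 - eC (y : ℂ)‖ / 2) :=
          div_le_div₀ (Real.exp_pos _).le hle (by positivity) hd.1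
      _ = _ := by field_simp
  · rw [abs_of_neg ht]
    have hq1 : 1 ≤ Real.exp (-(2 * Real.pi * t)) := by
      rw [Real.one_le_exp_iff]; nlinarith
    have hle : Real.exp (-(2 * Real.pi * t * x)) ≤
        Real.exp (-(2 * Real.pi * ε * -t)) * Real.exp (-(2 * Real.pi * t)) := by
      rw [← Real.exp_add, Real.exp_le_exp]
      have : 0 ≤ (2 * Real.pi * (-t)) * (1 - x - ε) :=
        mul_nonneg (mul_nonneg (by positivity) (by linarith)) (by linarith)
      nlinarith
    calc _ ≤ (Real.exp (-(2 * Real.pi * ε * -t)) * Real.exp (-(2 * Real.pi * t))) /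
            (Real.exp (-(2 * Real.pi * t)) * (‖1 - eC (y : ℂ)‖ / 2)) :=
          div_le_div₀ (by positivity) hle (by positivity) (hd.2 hq1)
      _ = _ := by field_simp

theorem aux_vecMul_bound {r : ℕ} (A : Matrix (Fin r) (Fin r) ℝ) (hA : A.det ≠ 0) :
    ∃ δ : ℝ, 0 < δ ∧ ∀ t : Fin r → ℝ, δ * ∑ μ, |t μ| ≤ ∑ ν, |Matrix.vecMul t A ν| := by
  set K : ℝ := (∑ ν, ∑ μ, |A⁻¹ ν μ|) + 1 with hK
  have hK0 : 0 < K := by positivity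
  refine ⟨K⁻¹, inv_pos.mpr hK0, fun t => ?_⟩
  rw [inv_mul_le_iff₀ hK0]
  have hu : IsUnit A.det := isUnit_iff_ne_zero.mpr hA
  have ht : t = Matrix.vecMul (Matrix.vecMul t A) A⁻¹ := by
    rw [Matrix.vecMul_vecMul, Matrix.mul_nonsing_inv _ hu, Matrix.vecMul_one]
  set w := Matrix.vecMul t A with hw
  have hS : ∀ ν, |w ν| ≤ ∑ ν, |w ν| := fun ν =>
    Finset.single_le_sum (f := fun ν => |w ν|) (fun i _ => abs_nonneg _) (Finset.mem_univ ν)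
  have hS0 : 0 ≤ ∑ ν, |w ν| := by positivity
  calc ∑ μ, |t μ| ≤ ∑ μ, ∑ ν, |A⁻¹ ν μ| * ∑ ν, |w ν| := by
        refine Finset.sum_le_sum fun μ _ => ?_
        have : t μ = ∑ ν, w ν * A⁻¹ ν μ := by
          conv_lhs => rw [ht]
          rfl
        rw [this]
        refine (Finset.abs_sum_le_sum_abs _ _).trans (Finset.sum_le_sum fun ν _ => ?_)
        rw [abs_mul, mul_comm]
        exact mul_le_mul_of_nonneg_left (hS ν) (abs_nonneg _)
    _ = (∑ ν, ∑ μ, |A⁻¹ ν μ|) * ∑ ν, |w ν| := by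
        rw [Finset.sum_comm, Finset.sum_mul]
        refine Finset.sum_congr rfl fun ν _ => ?_
        rw [Finset.sum_mul]
    _ ≤ K * ∑ ν, |w ν| := by
        apply mul_le_mul_of_nonneg_right _ hS0
        rw [hK]; linarith

/-- the integrand -/
def auxI {r : ℕ} (χ : Fin r → ℕ) (s : Fin r → ℂ)
    (A : Matrix (Fin r) (Fin r) ℝ) (x y : Fin r → ℝ) (t : Fin r → ℝ) : ℂ :=
  FF (Matrix.vecMul t A) x y * qchar χ s t * ∏ ν, ((t ν : ℝ) : ℂ)⁻¹

theorem aux_FF_bound {r : ℕ} (A : Matrix (Fin r) (Fin r) ℝ) (hA : A.det ≠ 0) (y : Fin r → ℝ)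
    (hy : ∀ ν, y ν ∈ Set.Ioo (0 : ℝ) 1) (ε : ℝ) (hε : 0 < ε) :
    ∃ C b : ℝ, 0 < b ∧ 0 ≤ C ∧ ∀ x : Fin r → ℝ, (∀ ν, ε ≤ x ν ∧ ε ≤ 1 - x ν) → ∀ t,
      ‖FF (Matrix.vecMul t A) x y‖ ≤ C * ∏ μ, Real.exp (-b * |t μ|) := by
  obtain ⟨δ, hδ, h⟩ := aux_vecMul_bound A hA
  refine ⟨∏ ν, (2 / ‖1 - eC (y ν : ℂ)‖), 2 * Real.pi * ε * δ, ?_, ?_, ?_⟩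
  · have := Real.pi_pos
    positivity
  · exact Finset.prod_nonneg fun _ _ => by positivity
  intro x hx t
  unfold FF
  rw [norm_prod]
  calc _ ≤ ∏ ν, ((2 / ‖1 - eC (y ν : ℂ)‖) *
        Real.exp (-(2 * Real.pi * ε * |Matrix.vecMul t A ν|))) :=
        Finset.prod_le_prod (fun _ _ => norm_nonneg _) fun ν _ =>
          aux_phi_bound (y ν) (hy ν) ε (x ν) (hx ν).1 (hx ν).2 _
    _ ≤ _ := by
        rw [Finset.prod_mul_distrib]
        refine mul_le_mul_of_nonneg_left ?_ (Finset.prod_nonneg fun _ _ => by positivity)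
        rw [← Real.exp_sum, ← Real.exp_sum, Real.exp_le_exp, Finset.sum_neg_distrib,
          ← Finset.mul_sum, ← Finset.mul_sum, neg_mul, neg_le_neg_iff, mul_assoc (2 * Real.pi * ε)]
        have := Real.pi_pos
        exact mul_le_mul_of_nonneg_left (h t) (by positivity)

theorem aux_factor_bound (k : ℕ) (s : ℂ) (t : ℝ) :
    ‖(Real.sign t : ℂ) ^ k * ((|t| : ℝ) : ℂ) ^ s * (t : ℂ)⁻¹‖ ≤ |t| ^ (s.re - 1) := by
  rcases eq_or_ne t 0 with rfl | ht
  · simp only [Complex.ofReal_zero, inv_zero, mul_zero, norm_zero]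
    positivity
  · have ha : 0 < |t| := abs_pos.mpr ht
    have hsg : ‖(Real.sign t : ℂ)‖ = 1 := by
      rcases Real.sign_apply_eq_of_ne_zero t ht with h | h <;> rw [h] <;> simp
    rw [norm_mul, norm_mul, norm_pow, hsg, one_pow, one_mul, norm_inv, Complex.norm_real,
      Real.norm_eq_abs, Complex.norm_cpow_eq_rpow_re_of_pos ha, Real.rpow_sub_one ha.ne']
    rfl

theorem aux_I_eq {r : ℕ} (χ : Fin r → ℕ) (s : Fin r → ℂ)
    (A : Matrix (Fin r) (Fin r) ℝ) (x y : Fin r → ℝ) (t : Fin r → ℝ) :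
    auxI χ s A x y t = FF (Matrix.vecMul t A) x y *
      ∏ ν, ((Real.sign (t ν) : ℂ) ^ (χ ν) * ((|t ν| : ℝ) : ℂ) ^ (s ν) * ((t ν : ℝ) : ℂ)⁻¹) := by
  unfold auxI qchar
  rw [mul_assoc, ← Finset.prod_mul_distrib]

/-- the dominating function -/
def auxB {r : ℕ} (b : ℝ) (s : Fin r → ℂ) (t : Fin r → ℝ) : ℝ :=
  ∏ μ, (|t μ| ^ ((s μ).re - 1) * Real.exp (-b * |t μ|))

theorem aux_I_bound {r : ℕ} (A : Matrix (Fin r) (Fin r) ℝ) (hA : A.det ≠ 0) (y : Fin r → ℝ)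
    (hy : ∀ ν, y ν ∈ Set.Ioo (0 : ℝ) 1) (ε : ℝ) (hε : 0 < ε) :
    ∃ C b : ℝ, 0 < b ∧ 0 ≤ C ∧ ∀ x : Fin r → ℝ, (∀ ν, ε ≤ x ν ∧ ε ≤ 1 - x ν) → ∀ χ s t,
      ‖auxI χ s A x y t‖ ≤ C * auxB b s t := by
  obtain ⟨C, b, hb, hC, h⟩ := aux_FF_bound A hA y hy ε hε
  refine ⟨C, b, hb, hC, fun x hx χ s t => ?_⟩
  rw [aux_I_eq, norm_mul, norm_prod]
  unfold auxB
  rw [Finset.prod_mul_distrib, mul_comm (∏ μ, |t μ| ^ ((s μ).re - 1)), ← mul_assoc]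
  refine mul_le_mul (h x hx t) ?_ (by positivity) (by positivity)
  exact Finset.prod_le_prod (fun _ _ => norm_nonneg _) fun ν _ => aux_factor_bound _ _ _

theorem aux_int1 (b σ : ℝ) (hb : 0 < b) (hσ : 0 < σ) :
    Integrable (fun t : ℝ => |t| ^ (σ - 1) * Real.exp (-b * |t|)) := by
  have h0 : IntegrableOn (fun t : ℝ => |t| ^ (σ - 1) * Real.exp (-b * |t|)) (Set.Ioi 0) := by
    have := integrableOn_rpow_mul_exp_neg_mul_rpow (p := 1) (s := σ - 1) (b := b)
      (by linarith) one_pos hb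
    refine this.congr_fun (fun t ht => ?_) measurableSet_Ioi
    have ht' : (0 : ℝ) < t := ht
    simp only [Real.rpow_one, abs_of_pos ht']
  have h1 : IntegrableOn (fun t : ℝ => |t| ^ (σ - 1) * Real.exp (-b * |t|)) (Set.Iio 0) := by
    have := (Measure.measurePreserving_neg (volume : Measure ℝ)).integrableOn_comp_preimage
      (Homeomorph.neg ℝ).measurableEmbedding
      (f := fun t : ℝ => |t| ^ (σ - 1) * Real.exp (-b * |t|)) (s := Set.Ioi 0)
    have h2 := this.mpr h0
    simpa [Function.comp_def] using h2
  rw [← integrableOn_univ, ← Set.Iio_union_Ici (a := (0 : ℝ)), integrableOn_union,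
    integrableOn_Ici_iff_integrableOn_Ioi]
  exact ⟨h1, h0⟩

theorem aux_B_int {r : ℕ} (b : ℝ) (hb : 0 < b) (s : Fin r → ℂ) (hs : ∀ ν, 0 < (s ν).re) :
    Integrable (fun t => auxB b s t) := by
  unfold auxB
  exact Integrable.fintype_prod (f := fun μ (t : ℝ) => |t| ^ ((s μ).re - 1) * Real.exp (-b * |t|))
    fun μ => aux_int1 b _ hb (hs μ)

theorem aux_sign_meas : Measurable Real.sign := by
  unfold Real.sign
  exact Measurable.ite measurableSet_Iio measurable_const
    (Measurable.ite measurableSet_Ioi measurable_const measurable_const)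

theorem aux_I_meas {r : ℕ} (χ : Fin r → ℕ) (s : Fin r → ℂ)
    (A : Matrix (Fin r) (Fin r) ℝ) (x y : Fin r → ℝ) :
    Measurable (auxI χ s A x y) := by
  have hv : ∀ ν, Measurable fun t : Fin r → ℝ => Matrix.vecMul t A ν := by
    intro ν
    unfold Matrix.vecMul dotProduct
    fun_prop
  have hs := aux_sign_meas
  have he : Measurable eC := by unfold eC; fun_prop
  unfold auxI FF qchar phiF
  refine (Measurable.mul ?_ ?_).mul (by fun_prop)
  · refine Finset.measurable_prod _ fun ν _ => ?_
    have := hv ν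
    fun_prop
  · refine Finset.measurable_prod _ fun ν _ => ?_
    fun_prop

theorem aux_shift {r : ℕ} (χ : Fin r → ℕ) (hχ : ∀ ν, χ ν ≤ 1) (s : Fin r → ℂ)
    (A : Matrix (Fin r) (Fin r) ℝ) (x y : Fin r → ℝ) (t : Fin r → ℝ) (μ : Fin r) :
    auxI (fun ρ => if ρ = μ then (χ ρ + 1) % 2 else χ ρ)
          (fun ρ => if ρ = μ then s ρ + 1 else s ρ) A x y t = (t μ : ℂ) * auxI χ s A x y t := by
  rw [aux_I_eq, aux_I_eq, mul_left_comm]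
  congr 1
  have : (t μ : ℂ) = ∏ ρ, if ρ = μ then (t ρ : ℂ) else 1 := by simp
  rw [this, ← Finset.prod_mul_distrib]
  refine Finset.prod_congr rfl fun ρ _ => ?_
  by_cases h : ρ = μ
  · simp only [h, if_true]
    rcases eq_or_ne (t μ) 0 with h0 | h0
    · simp [h0]
    · have ha : ((|t μ| : ℝ) : ℂ) ≠ 0 := by exact_mod_cast (abs_pos.mpr h0).ne'
      rw [Complex.cpow_add _ _ ha, Complex.cpow_one]
      have hk : χ μ = 0 ∨ χ μ = 1 := by have := hχ μ; omega
      rcases lt_or_gt_of_ne h0 with hn | hn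
      · rw [Real.sign_of_neg hn, abs_of_neg hn]
        rcases hk with hk | hk <;> rw [hk] <;> push_cast <;> norm_num <;> ring
      · rw [Real.sign_of_pos hn, abs_of_pos hn]
        rcases hk with hk | hk <;> rw [hk] <;> push_cast <;> norm_num <;> ring
  · simp only [h, if_false, one_mul]

theorem aux_deriv {r : ℕ} (χ : Fin r → ℕ) (s : Fin r → ℂ)
    (A : Matrix (Fin r) (Fin r) ℝ) (x y : Fin r → ℝ) (t : Fin r → ℝ) (ν : Fin r) (u : ℝ) :
    HasDerivAt (fun u : ℝ => auxI χ s A (Function.update x ν u) y t)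
      (-(2 * Real.pi) * ((Matrix.vecMul t A ν : ℝ) : ℂ) * auxI χ s A (Function.update x ν u) y t) u := by
  have h : ∀ u : ℝ, auxI χ s A (Function.update x ν u) y t =
      ((Real.exp (-(2 * Real.pi * Matrix.vecMul t A ν * u)) : ℝ) : ℂ) *
        ((1 - eC (y ν + Complex.I * (Matrix.vecMul t A ν : ℝ)))⁻¹ *
          (∏ ρ ∈ Finset.univ.erase ν, phiF (Matrix.vecMul t A ρ) (x ρ) (y ρ)) *
          (qchar χ s t * ∏ ν, ((t ν : ℝ) : ℂ)⁻¹)) := by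
    intro u
    unfold auxI FF
    rw [← Finset.mul_prod_erase _ _ (Finset.mem_univ ν)]
    have : ∏ ρ ∈ Finset.univ.erase ν, phiF (Matrix.vecMul t A ρ) (Function.update x ν u ρ) (y ρ) =
        ∏ ρ ∈ Finset.univ.erase ν, phiF (Matrix.vecMul t A ρ) (x ρ) (y ρ) := by
      refine Finset.prod_congr rfl fun ρ hρ => ?_
      rw [Function.update_of_ne (Finset.ne_of_mem_erase hρ)]
    rw [this, Function.update_self]
    unfold phiF
    rw [aux_num]
    ring
  simp only [h]
  have h1 : HasDerivAt (fun u : ℝ => Real.exp (-(2 * Real.pi * Matrix.vecMul t A ν * u)))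
      (Real.exp (-(2 * Real.pi * Matrix.vecMul t A ν * u)) *
        (-(2 * Real.pi * Matrix.vecMul t A ν * 1))) u :=
    (((hasDerivAt_id u).const_mul _).neg).exp
  have h2 := h1.ofReal_comp.mul_const ((1 - eC (y ν + Complex.I * (Matrix.vecMul t A ν : ℝ)))⁻¹ *
          (∏ ρ ∈ Finset.univ.erase ν, phiF (Matrix.vecMul t A ρ) (x ρ) (y ρ)) *
          (qchar χ s t * ∏ ν, ((t ν : ℝ) : ℂ)⁻¹))
  refine h2.congr_deriv ?_
  push_cast
  ring

theorem aux_GammaC_succ (s : ℂ) (hs : 0 < s.re) :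
    GammaC (s + 1) = s / (2 * Real.pi) * GammaC s := by
  have h0 : s ≠ 0 := by rintro rfl; simp at hs
  have hp : (2 * (Real.pi : ℂ)) ≠ 0 := by
    simp [Real.pi_ne_zero]
  unfold GammaC
  rw [Complex.Gamma_add_one s h0, neg_add, Complex.cpow_add _ _ hp, Complex.cpow_neg_one]
  field_simp

theorem aux_GammaC_prod {r : ℕ} (s : Fin r → ℂ) (hs : ∀ ν, 0 < (s ν).re) (μ : Fin r) :
    ∏ ρ, GammaC (if ρ = μ then s ρ + 1 else s ρ) = s μ / (2 * Real.pi) * ∏ ρ, GammaC (s ρ) := by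
  have : s μ / (2 * Real.pi : ℂ) = ∏ ρ, if ρ = μ then s ρ / (2 * Real.pi : ℂ) else 1 := by simp
  rw [this, ← Finset.prod_mul_distrib]
  refine Finset.prod_congr rfl fun ρ _ => ?_
  by_cases h : ρ = μ
  · simp only [h, if_true]
    exact aux_GammaC_succ _ (hs μ)
  · simp only [h, if_false, one_mul]

/-- the derivative of the integrand -/
def auxD {r : ℕ} (χ : Fin r → ℕ) (s : Fin r → ℂ)
    (A : Matrix (Fin r) (Fin r) ℝ) (ν : Fin r) (y x : Fin r → ℝ) (t : Fin r → ℝ) : ℂ :=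
  ∑ μ, (-(2 * Real.pi) * (A μ ν : ℂ)) *
    auxI (fun ρ => if ρ = μ then (χ ρ + 1) % 2 else χ ρ)
      (fun ρ => if ρ = μ then s ρ + 1 else s ρ) A x y t

theorem aux_L {r : ℕ} (χ : Fin r → ℕ) (s : Fin r → ℂ)
    (A : Matrix (Fin r) (Fin r) ℝ) (x y : Fin r → ℝ) :
    ShintaniLchi χ s A x y = (∏ ν, GammaC (s ν))⁻¹ * ∫ t, auxI χ s A x y t := rfl

theorem stmt_14 (r : ℕ) (hr : 1 ≤ r) (χ : Fin r → ℕ) (hχ : ∀ ν, χ ν ≤ 1)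
    (A : Matrix (Fin r) (Fin r) ℝ) (hA : A.det ≠ 0) (x y : Fin r → ℝ)
    (hx : ∀ ν, x ν ∈ Set.Ioo (0 : ℝ) 1) (hy : ∀ ν, y ν ∈ Set.Ioo (0 : ℝ) 1)
    (s : Fin r → ℂ) (hs : ∀ ν, 0 < (s ν).re) (ν : Fin r) :
    HasDerivAt (fun u : ℝ => ShintaniLchi χ s A (Function.update x ν u) y)
      (-∑ μ, ((A μ ν : ℝ) : ℂ) * s μ *
        ShintaniLchi (fun ρ => if ρ = μ then (χ ρ + 1) % 2 else χ ρ)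
          (fun ρ => if ρ = μ then s ρ + 1 else s ρ) A x y)
      (x ν) := by
  have hsp : ∀ μ ρ, 0 < ((if ρ = μ then s ρ + 1 else s ρ : ℂ)).re := by
    intro μ ρ
    have := hs ρ
    split_ifs
    · simp only [Complex.add_re, Complex.one_re]; linarith
    · exact this
  obtain ⟨ε, hε, hxε⟩ : ∃ ε : ℝ, 0 < ε ∧ ∀ ρ, 2 * ε ≤ x ρ ∧ 2 * ε ≤ 1 - x ρ := by
    have h1 : ∀ᶠ ε : ℝ in nhdsWithin 0 (Set.Ioi 0), ∀ ρ, 2 * ε ≤ x ρ ∧ 2 * ε ≤ 1 - x ρ := by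
      rw [Filter.eventually_all]
      intro ρ
      have hpos : 0 < min (x ρ) (1 - x ρ) / 2 := by
        have h1 := (hx ρ).1
        have h2 := (hx ρ).2
        have : 0 < min (x ρ) (1 - x ρ) := lt_min h1 (by linarith)
        linarith
      filter_upwards [Ioo_mem_nhdsGT hpos] with e he
      have h3 := min_le_left (x ρ) (1 - x ρ)
      have h4 := min_le_right (x ρ) (1 - x ρ)
      have h5 := he.2
      constructor <;> linarith
    obtain ⟨ε, h2, h3⟩ := (h1.and self_mem_nhdsWithin).exists
    exact ⟨ε, h3, h2⟩
  have hup : ∀ u ∈ Metric.ball (x ν) ε, ∀ ρ,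
      ε ≤ Function.update x ν u ρ ∧ ε ≤ 1 - Function.update x ν u ρ := by
    intro u hu ρ
    have h1 := hxε ρ
    rw [Metric.mem_ball, Real.dist_eq, abs_lt] at hu
    by_cases h : ρ = ν
    · subst h
      rw [Function.update_self]
      constructor <;> linarith [h1.1, h1.2, hu.1, hu.2]
    · rw [Function.update_of_ne h]
      constructor <;> linarith [h1.1, h1.2]
  obtain ⟨C, b, hb, hC, hbd⟩ := aux_I_bound A hA y hy ε hε
  have hint : ∀ (χ' : Fin r → ℕ) (s' : Fin r → ℂ), (∀ ρ, 0 < (s' ρ).re) →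
      ∀ u ∈ Metric.ball (x ν) ε, Integrable (auxI χ' s' A (Function.update x ν u) y) := by
    intro χ' s' hs' u hu
    exact ((aux_B_int b hb s' hs').const_mul C).mono' (aux_I_meas _ _ _ _ _).aestronglyMeasurable
      (Filter.Eventually.of_forall fun t => hbd _ (hup u hu) χ' s' t)
  have hmem : x ν ∈ Metric.ball (x ν) ε := Metric.mem_ball_self hε
  have hF' : ∀ (u : ℝ) (t : Fin r → ℝ),
      -(2 * Real.pi) * ((Matrix.vecMul t A ν : ℝ) : ℂ) *
        auxI χ s A (Function.update x ν u) y t =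
      auxD χ s A ν y (Function.update x ν u) t := by
    intro u t
    unfold auxD
    have h1 : ((Matrix.vecMul t A ν : ℝ) : ℂ) = ∑ μ, (t μ : ℂ) * (A μ ν : ℂ) := by
      rw [show Matrix.vecMul t A ν = ∑ μ, t μ * A μ ν from rfl]
      push_cast
      rfl
    rw [h1, Finset.mul_sum, Finset.sum_mul]
    refine Finset.sum_congr rfl fun μ _ => ?_
    rw [aux_shift χ hχ s]
    ring
  have hm : AEStronglyMeasurable (auxD χ s A ν y (Function.update x ν (x ν))) volume := by
    unfold auxD
    exact (Finset.measurable_fun_sum _ fun μ _ =>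
      (aux_I_meas _ _ _ _ _).const_mul _).aestronglyMeasurable
  have hbnd : ∀ t, ∀ u ∈ Metric.ball (x ν) ε, ‖auxD χ s A ν y (Function.update x ν u) t‖ ≤
      ∑ μ, ‖(-(2 * Real.pi) * (A μ ν : ℂ))‖ *
        (C * auxB b (fun ρ => if ρ = μ then s ρ + 1 else s ρ) t) := by
    intro t u hu
    unfold auxD
    refine (norm_sum_le _ _).trans (Finset.sum_le_sum fun μ _ => ?_)
    rw [norm_mul]
    exact mul_le_mul_of_nonneg_left (hbd _ (hup u hu) _ _ t) (norm_nonneg _)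
  have hbi : Integrable (fun t => ∑ μ, ‖(-(2 * Real.pi) * (A μ ν : ℂ))‖ *
        (C * auxB b (fun ρ => if ρ = μ then s ρ + 1 else s ρ) t)) :=
    integrable_finsetSum _ fun μ _ =>
      ((aux_B_int b hb _ (hsp μ)).const_mul C).const_mul _
  have hder : ∀ t, ∀ u ∈ Metric.ball (x ν) ε,
      HasDerivAt (fun u : ℝ => auxI χ s A (Function.update x ν u) y t)
        (auxD χ s A ν y (Function.update x ν u) t) u := by
    intro t u _
    exact (aux_deriv χ s A x y t ν u).congr_deriv (hF' u t)
  have key := (hasDerivAt_integral_of_dominated_loc_of_deriv_le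
    (μ := (volume : Measure (Fin r → ℝ)))
    (F := fun (u : ℝ) t => auxI χ s A (Function.update x ν u) y t)
    (F' := fun (u : ℝ) t => auxD χ s A ν y (Function.update x ν u) t)
    (Metric.ball_mem_nhds (x ν) hε)
    (Filter.Eventually.of_forall fun u => (aux_I_meas _ _ _ _ _).aestronglyMeasurable)
    (hint χ s hs _ hmem) hm
    (Filter.Eventually.of_forall hbnd) hbi
    (Filter.Eventually.of_forall hder)).2
  have key2 := key.const_mul (∏ ν, GammaC (s ν))⁻¹
  simp only [aux_L]
  refine key2.congr_deriv ?_
  symm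
  unfold auxD
  rw [integral_finsetSum _ fun μ _ => (hint _ _ (hsp μ) _ hmem).const_mul _]
  rw [Finset.mul_sum, ← Finset.sum_neg_distrib]
  refine Finset.sum_congr rfl fun μ _ => ?_
  rw [integral_const_mul, aux_GammaC_prod s hs μ, Function.update_eq_self]
  have h0 : s μ ≠ 0 := by
    intro h
    have := hs μ
    rw [h] at this
    simp at this
  have hp : (Real.pi : ℂ) ≠ 0 := by simp [Real.pi_ne_zero]
  rw [mul_inv]
  field_simp

end
end
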